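/- There exist an integer q > 0 and a real number L ≥ 1 such that for every N ≥ 1, every 0 < p < 1, and every subset A of {0,1}^N with μ_p(A) ≥ 1 − 1/q, the set A^(q) is p^L-small. -/

import Mathlib

open Finset

/-- The product measure `μ_p = ((1-p)δ₀ + pδ₁)^{⊗N}` of a set `S ⊆ {0,1}^N`. -/
noncomputable def mup (N : ℕ) (p : ℝ) (S : Set (Fin N → Bool)) : ℝ :=
  ∑ x : Fin N → Bool, Set.indicator S (fun x => ∏ i, if x i then p else 1 - p) x

/-- The upper set `H_I = {J ⊆ [N] : I ⊆ J}`, viewed inside `{0,1}^N`. -/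
def HIset (N : ℕ) (I : Finset (Fin N)) : Set (Fin N → Bool) :=
  {x | ∀ i ∈ I, x i = true}

/-- `S ⊆ {0,1}^N` is `p`-small: it is covered by sets `H_I`, `I ∈ 𝓘`, with
`Σ_{I ∈ 𝓘} p^{|I|} ≤ 1/2`. -/
def PSmall (N : ℕ) (p : ℝ) (S : Set (Fin N → Bool)) : Prop :=
  ∃ 𝓘 : Finset (Finset (Fin N)),
    (S ⊆ ⋃ I ∈ 𝓘, HIset N I) ∧ (∑ I ∈ 𝓘, p ^ I.card ≤ 1 / 2)

/-- `A^(q)`: the set of `x ∈ {0,1}^N` such that for any `x⁽¹⁾, …, x⁽q⁾ ∈ A` there is a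
coordinate `i` with `x_i = 1` and `x_i⁽¹⁾ = ⋯ = x_i⁽q⁾ = 0`. -/
def uncoverable (N q : ℕ) (A : Set (Fin N → Bool)) : Set (Fin N → Bool) :=
  {x | ∀ y : Fin q → (Fin N → Bool), (∀ j, y j ∈ A) →
    ∃ i : Fin N, x i = true ∧ ∀ j, y j i = false}

namespace SmallSets

section Weights

variable {V : Type*} [Fintype V] [DecidableEq V]

/-- The `p`-biased weight of a finite set. -/
noncomputable def wt (p : ℝ) (S : Finset V) : ℝ := ∏ x, if x ∈ S then p else 1 - p

lemma wt_nonneg {p : ℝ} (h0 : 0 ≤ p) (h1 : p ≤ 1) (S : Finset V) : 0 ≤ wt p S :=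
  prod_nonneg fun x _ => by split_ifs <;> linarith

lemma sum_comp_pi {α β γ : Type*} [Fintype α] [DecidableEq α] [Fintype β]
    [Fintype γ] [DecidableEq γ] (φ : β → ℝ) (r : β → γ) (F : (α → γ) → ℝ) :
    ∑ f : α → β, (∏ x, φ (f x)) * F (fun x => r (f x)) =
      ∑ u : α → γ, (∏ x, ∑ q with r q = u x, φ q) * F u := by
  classical
  rw [← sum_fiberwise univ (fun (f : α → β) x => r (f x))]
  refine sum_congr rfl fun u _ => ?_
  rw [prod_univ_sum, sum_mul]
  have : (univ.filter fun f : α → β => (fun x => r (f x)) = u) =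
      Fintype.piFinset fun x => univ.filter fun q => r q = u x := by
    ext f; simp [funext_iff]
  rw [this]
  refine sum_congr rfl fun f hf => ?_
  have : (fun x => r (f x)) = u := by
    ext x
    have := (Fintype.mem_piFinset.1 hf) x
    simpa using this
  rw [this]

/-- Boolean functions as finite sets. -/
def boolEquiv (V : Type*) [Fintype V] [DecidableEq V] : (V → Bool) ≃ Finset V where
  toFun f := univ.filter fun x => f x = true
  invFun S x := decide (x ∈ S)
  left_inv f := by ext x; simp
  right_inv S := by ext x; simp

lemma mem_boolEquiv (f : V → Bool) (x : V) : x ∈ boolEquiv V f ↔ f x = true := by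
  simp [boolEquiv]

lemma sum_wt_mul (p : ℝ) (F : Finset V → ℝ) :
    ∑ S, wt p S * F S = ∑ f : V → Bool, (∏ x, if f x then p else 1 - p) * F (boolEquiv V f) := by
  rw [← (boolEquiv V).sum_comp]
  simp only [wt, mem_boolEquiv]

lemma sum_wt (p : ℝ) : ∑ S : Finset V, wt p S = 1 := by
  have h := sum_wt_mul (V := V) p (fun _ => 1)
  simp only [mul_one] at h
  rw [h]
  have := prod_univ_sum (fun _ : V => (univ : Finset Bool))
    (fun _ b => if b then p else 1 - p)
  simp only [Fintype.piFinset_univ] at this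
  rw [← this]
  simp

lemma wt_sdiff_mul {p : ℝ} (h0 : 0 ≤ p) (h1 : p ≤ 1) {T Z : Finset V} (h : T ⊆ Z) :
    wt p (Z \ T) * p ^ #T ≤ wt p Z := by
  have : p ^ #T = ∏ x, if x ∈ T then p else 1 := by
    rw [prod_ite, prod_const, prod_const_one, mul_one]; congr 2; ext; simp
  rw [this, wt, wt, ← prod_mul_distrib]
  refine prod_le_prod (fun x _ => ?_) fun x _ => ?_
  · split_ifs <;> positivity
  · have := @h x
    by_cases hT : x ∈ T
    · simp only [mem_sdiff, hT, this hT, not_true, and_false, if_true, if_false]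
      nlinarith
    · simp [hT]

lemma sum_wt_union {a b : ℝ} (F : Finset V → ℝ) :
    ∑ S, ∑ T, wt a S * wt b T * F (S ∪ T) = ∑ U, wt (a + b - a * b) U * F U := by
  have key := sum_comp_pi (α := V) (β := Bool × Bool) (γ := Bool)
    (fun q => (if q.1 then a else 1 - a) * (if q.2 then b else 1 - b)) (fun q => q.1 || q.2)
    (fun f => F (boolEquiv V f))
  have e : ∑ S, ∑ T, wt a S * wt b T * F (S ∪ T) =
      ∑ f : V → Bool × Bool, (∏ x, (if (f x).1 then a else 1 - a) *
        (if (f x).2 then b else 1 - b)) * F (boolEquiv V fun x => (f x).1 || (f x).2) := by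
    rw [← (boolEquiv V).sum_comp, ←
      (Equiv.arrowProdEquivProdArrow V (fun _ => Bool) (fun _ => Bool)).symm.sum_comp,
      Fintype.sum_prod_type]
    refine sum_congr rfl fun f _ => ?_
    rw [← (boolEquiv V).sum_comp]
    refine sum_congr rfl fun g _ => ?_
    have : boolEquiv V f ∪ boolEquiv V g = boolEquiv V fun x => f x || g x := by
      ext x; simp [mem_boolEquiv]
    simp only [wt, mem_boolEquiv, this, prod_mul_distrib, Equiv.arrowProdEquivProdArrow]
    rfl
  rw [e, key, sum_wt_mul]
  refine sum_congr rfl fun u _ => ?_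
  congr 1
  refine prod_congr rfl fun x _ => ?_
  rw [sum_filter, Fintype.sum_prod_type]
  cases u x <;> simp <;> ring

lemma sum_wt_antitone {a c : ℝ} (h0 : 0 ≤ a) (hac : a ≤ c) (hc : c ≤ 1) {F : Finset V → ℝ}
    (hF : Antitone F) : ∑ S, wt c S * F S ≤ ∑ S, wt a S * F S := by
  rcases eq_or_lt_of_le (hac.trans hc) with h | h
  · obtain rfl : a = c := by linarith
    exact le_rfl
  set b := (c - a) / (1 - a) with hb
  have h1a : (0:ℝ) < 1 - a := by linarith
  have hb0 : 0 ≤ b := div_nonneg (by linarith) h1a.le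
  have hb1 : b ≤ 1 := by rw [hb, div_le_one h1a]; linarith
  have hcb : c = a + b - a * b := by rw [hb]; field_simp; ring
  rw [hcb, ← sum_wt_union]
  refine sum_le_sum fun S _ => ?_
  calc ∑ T, wt a S * wt b T * F (S ∪ T) ≤ ∑ T, wt a S * wt b T * F S :=
        sum_le_sum fun T _ => mul_le_mul_of_nonneg_left (hF subset_union_left)
          (mul_nonneg (wt_nonneg h0 (by linarith) S) (wt_nonneg hb0 hb1 T))
    _ = wt a S * F S := by
        rw [← sum_mul, ← mul_sum, sum_wt, mul_one]

/-- A uniform random colouring with `m` colours has `1/m`-biased colour classes. -/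
lemma sum_colouring {m : ℕ} (hm : 0 < m) (j : Fin m) (F : Finset V → ℝ) :
    ∑ c : V → Fin m, (∏ _x : V, (1 / m : ℝ)) * F (univ.filter fun x => c x = j) =
      ∑ S, wt (1 / m : ℝ) S * F S := by
  have key := sum_comp_pi (α := V) (β := Fin m) (γ := Bool)
    (fun _ => (1 / m : ℝ)) (fun q => decide (q = j)) (fun f => F (boolEquiv V f))
  have e : ∀ c : V → Fin m, (univ.filter fun x => c x = j) =
      boolEquiv V fun x => decide (c x = j) := by
    intro c; ext x; simp [mem_boolEquiv]
  simp only [e]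
  rw [key, sum_wt_mul]
  refine sum_congr rfl fun u _ => ?_
  congr 1
  refine prod_congr rfl fun x _ => ?_
  have hm' : (m : ℝ) ≠ 0 := by positivity
  cases u x
  · have : (univ.filter fun q : Fin m => decide (q = j) = false) = univ.erase j := by
      ext q; simp
    rw [this, sum_const, card_erase_of_mem (mem_univ _), card_univ, Fintype.card_fin,
      nsmul_eq_mul, Nat.cast_pred hm]
    simp; field_simp
  · have : (univ.filter fun q : Fin m => decide (q = j) = true) = {j} := by
      ext q; simp
    rw [this]; simp

end Weights

section Fragments

variable {V : Type*} [Fintype V] [DecidableEq V]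

/-- `W` captures at least half of the `h`-mass of `R`. -/
def Good (h : V → ℝ) (R W : Finset V) : Prop := ∑ x ∈ R, h x ≤ 2 * ∑ x ∈ R ∩ W, h x

/-- The part of `R` where `h` is at least `h x`. -/
noncomputable def lev (h : V → ℝ) (R : Finset V) (x : V) : Finset V := R.filter fun y => h x ≤ h y

omit [Fintype V] [DecidableEq V] in
lemma sum_mul_nonneg_of_lev (n : ℕ) : ∀ (R : Finset V) (h f : V → ℝ), #R ≤ n →
    (∀ x ∈ R, 0 ≤ h x) → (∀ x ∈ R, 0 ≤ ∑ y ∈ lev h R x, f y) → 0 ≤ ∑ x ∈ R, f x * h x := by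
  induction n with
  | zero =>
    intro R h f hR _ _
    rw [card_eq_zero.1 (Nat.le_zero.1 hR)]; simp
  | succ n ih =>
    intro R h f hR hh hf
    rcases R.eq_empty_or_nonempty with rfl | hne
    · simp
    obtain ⟨x₀, hx₀, hmin⟩ := exists_min_image R h hne
    set R' := R.filter fun y => h x₀ < h y with hR'
    have hlt : #R' ≤ n := by
      have : R' ⊂ R := by
        refine ⟨filter_subset _ _, fun hh' => ?_⟩
        have := (mem_filter.1 (hh' hx₀)).2
        exact lt_irrefl _ this
      have := card_lt_card this
      omega
    have h1 := ih R' (fun y => h y - h x₀) f hlt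
      (fun x hx => sub_nonneg.2 (mem_filter.1 hx).2.le) (fun x hx => by
        have hx' := mem_filter.1 hx
        have : lev (fun y => h y - h x₀) R' x = lev h R x := by
          ext y
          simp only [lev, mem_filter, hR', sub_le_sub_iff_right]
          constructor
          · rintro ⟨⟨a, _⟩, b⟩; exact ⟨a, b⟩
          · rintro ⟨a, b⟩; exact ⟨⟨a, hx'.2.trans_le b⟩, b⟩
        rw [this]
        exact hf x hx'.1)
    have h2 : ∑ x ∈ R', f x * (h x - h x₀) = ∑ x ∈ R, f x * (h x - h x₀) := by
      refine sum_subset (filter_subset _ _) fun x hx hx' => ?_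
      have : ¬ h x₀ < h x := fun hlt => hx' (mem_filter.2 ⟨hx, hlt⟩)
      have : h x = h x₀ := le_antisymm (not_lt.1 this) (hmin x hx)
      rw [this]; ring
    have h3 : lev h R x₀ = R := filter_true_of_mem hmin
    have h4 := hf x₀ hx₀
    rw [h3] at h4
    have h5 : ∑ x ∈ R, f x * h x = ∑ x ∈ R, f x * (h x - h x₀) + h x₀ * ∑ x ∈ R, f x := by
      rw [mul_sum, ← sum_add_distrib]; exact sum_congr rfl fun x _ => by ring
    rw [h5, ← h2]
    exact add_nonneg h1 (mul_nonneg (hh _ hx₀) h4)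

omit [Fintype V] in
lemma exists_lev_of_not_good {h : V → ℝ} (hh : ∀ x, 0 ≤ h x) {R W : Finset V}
    (hb : ¬ Good h R W) : ∃ x ∈ R, #(lev h R x) ≤ 2 * #(lev h R x \ W) := by
  by_contra! hcon
  apply hb
  have := sum_mul_nonneg_of_lev #R R h (fun x => if x ∈ W then 1 else -1) le_rfl
    (fun x _ => hh x) (fun x hx => by
      have h1 := hcon x hx
      rw [← sum_filter_add_sum_filter_not _ (fun y => y ∈ W), sum_congr rfl (g := fun _ => (1:ℝ)),
        sum_congr (s₁ := filter (fun y => y ∉ W) _) rfl (g := fun _ => (-1:ℝ))]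
      · have e1 := card_filter_add_card_filter_not (s := lev h R x) (fun y => y ∈ W)
        have e2 : lev h R x \ W = filter (fun y => y ∉ W) (lev h R x) := by
          ext; simp
        rw [e2] at h1
        have : (#(filter (fun y => y ∉ W) (lev h R x)) : ℝ) ≤
            #(filter (fun y => y ∈ W) (lev h R x)) := by
          exact_mod_cast (by omega)
        simp only [sum_const, nsmul_eq_mul]
        linarith
      · intro y hy; simp [(mem_filter.1 hy).2]
      · intro y hy; simp [(mem_filter.1 hy).2])
  have e : ∀ x, (if x ∈ W then (1:ℝ) else -1) * h x = 2 * (if x ∈ W then h x else 0) - h x := by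
    intro x; split_ifs <;> ring
  simp only [e, sum_sub_distrib, ← mul_sum] at this
  rw [← sum_filter, filter_mem_eq_inter] at this
  unfold Good
  linarith

omit [Fintype V] [DecidableEq V] in
lemma lev_subset_of_card_le {h : V → ℝ} {R : Finset V} {x y : V}
    (hc : #(lev h R x) ≤ #(lev h R y)) : lev h R x ⊆ lev h R y := by
  rcases le_total (h y) (h x) with hxy | hxy
  · exact fun z hz => mem_filter.2 ⟨(mem_filter.1 hz).1, hxy.trans (mem_filter.1 hz).2⟩
  · have : lev h R y ⊆ lev h R x :=
      fun z hz => mem_filter.2 ⟨(mem_filter.1 hz).1, hxy.trans (mem_filter.1 hz).2⟩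
    exact (eq_of_subset_of_card_le this hc).ge

variable {ι : Type*} (R : ι → Finset V) (h : ι → V → ℝ) (X : Finset ι)

/-- `x` gives the largest level set of `R i` of which at least half is missed by `W`. -/
def Crit (W : Finset V) (i : ι) (x : V) : Prop :=
  x ∈ R i ∧ #(lev (h i) (R i) x) ≤ 2 * #(lev (h i) (R i) x \ W) ∧
    ∀ y ∈ R i, #(lev (h i) (R i) x) < #(lev (h i) (R i) y) →
      2 * #(lev (h i) (R i) y \ W) < #(lev (h i) (R i) y)

/-- Sizes `(k, t)` for which a fragment of `R i₀` with these parameters exists. -/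
def Frag (W : Finset V) (i₀ : ι) (k : ℕ) (T : Finset V) : Prop :=
  ∃ i ∈ X, ∃ x, Crit R h W i x ∧ #(lev (h i) (R i) x) = k ∧ T = lev (h i) (R i) x \ W ∧ T ⊆ R i₀

/-- The candidates for reconstructing a fragment of size `t` from its union with `W`. -/
def Cand (Z : Finset V) (k t : ℕ) (C : Finset V) : Prop :=
  ∃ i ∈ X, ∃ x ∈ R i, C = lev (h i) (R i) x ∧ #C = k ∧ C ⊆ Z ∧
    ∀ y ∈ R i, k < #(lev (h i) (R i) y) →
      2 * #(lev (h i) (R i) y \ Z) + 2 * t < #(lev (h i) (R i) y)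

variable {R h X}

omit [Fintype V] in
lemma exists_crit (hh : ∀ i x, 0 ≤ h i x) {W : Finset V} {i : ι} (hb : ¬ Good (h i) (R i) W) :
    ∃ x, Crit R h W i x := by
  classical
  obtain ⟨x, hx, hx'⟩ := exists_lev_of_not_good (hh i) hb
  obtain ⟨z, hz, hmax⟩ := exists_max_image
    ((R i).filter fun x => #(lev (h i) (R i) x) ≤ 2 * #(lev (h i) (R i) x \ W))
    (fun x => #(lev (h i) (R i) x)) ⟨x, mem_filter.2 ⟨hx, hx'⟩⟩
  refine ⟨z, (mem_filter.1 hz).1, (mem_filter.1 hz).2, fun y hy hlt => ?_⟩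
  by_contra hcon
  have := hmax y (mem_filter.2 ⟨hy, not_lt.1 hcon⟩)
  omega

omit [Fintype V] in
lemma exists_fragment (hh : ∀ i x, 0 ≤ h i x) {W : Finset V}
    (hb : ∀ i ∈ X, ¬ Good (h i) (R i) W) {i₀ : ι} (hi₀ : i₀ ∈ X) :
    ∃ k T, T ⊆ R i₀ ∧ Disjoint T W ∧ 1 ≤ #T ∧ k ≤ 2 * #T ∧
      (∃ C, Cand R h X (W ∪ T) k #T C) ∧ ∀ C, Cand R h X (W ∪ T) k #T C → T ⊆ C := by
  classical
  obtain ⟨x₀, hx₀⟩ := exists_crit hh (hb i₀ hi₀)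
  have hne : ∃ k, ∃ T, Frag R h X W i₀ k T :=
    ⟨_, _, i₀, hi₀, x₀, hx₀, rfl, rfl, sdiff_subset.trans (filter_subset _ _)⟩
  set k := Nat.find hne with hk
  have hkmin : ∀ k', (∃ T, Frag R h X W i₀ k' T) → k ≤ k' := fun k' hk' => Nat.find_min' hne hk'
  have hne2 : ∃ t, ∃ T, Frag R h X W i₀ k T ∧ #T = t := by
    obtain ⟨T, hT⟩ := Nat.find_spec hne
    exact ⟨_, T, hT, rfl⟩
  set t := Nat.find hne2 with ht
  obtain ⟨T, hT, hTt⟩ : ∃ T, Frag R h X W i₀ k T ∧ #T = t := Nat.find_spec hne2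
  have htmin : ∀ T', Frag R h X W i₀ k T' → t ≤ #T' :=
    fun T' hT' => Nat.find_min' hne2 ⟨T', hT', rfl⟩
  clear_value k t
  obtain ⟨i, hi, x, hx, hxk, hTx, hTR⟩ := hT
  have hxmem : x ∈ lev (h i) (R i) x := mem_filter.2 ⟨hx.1, le_rfl⟩
  have hkpos : 0 < k := by rw [← hxk]; exact card_pos.2 ⟨x, hxmem⟩
  have hk2 : k ≤ 2 * #T := by
    have := hx.2.1
    rw [hxk, ← hTx] at this; exact this
  have hdis : Disjoint T W := by rw [hTx]; exact sdiff_disjoint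
  refine ⟨k, T, hTR, hdis, by omega, hk2, ⟨_, i, hi, x, hx.1, rfl, hxk, ?_, ?_⟩, ?_⟩
  · intro y hy
    by_cases hyW : y ∈ W
    · exact mem_union_left _ hyW
    · exact mem_union_right _ (by rw [hTx]; exact mem_sdiff.2 ⟨hy, hyW⟩)
  · intro y hy hlt
    have h1 := hx.2.2 y hy (by rw [hxk]; exact hlt)
    have hsub : lev (h i) (R i) x ⊆ lev (h i) (R i) y := lev_subset_of_card_le (by omega)
    have h2 : lev (h i) (R i) y \ W = (lev (h i) (R i) y \ (W ∪ T)) ∪ T := by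
      ext z
      simp only [mem_sdiff, mem_union]
      constructor
      · rintro ⟨a, b⟩; tauto
      · rintro (⟨a, b⟩ | b)
        · tauto
        · refine ⟨hsub ?_, fun hzW => disjoint_left.1 hdis b hzW⟩
          rw [hTx] at b; exact (mem_sdiff.1 b).1
    have h3 : Disjoint (lev (h i) (R i) y \ (W ∪ T)) T :=
      disjoint_left.2 fun z hz hz' => (mem_sdiff.1 hz).2 (mem_union_right _ hz')
    rw [h2, card_union_of_disjoint h3] at h1
    omega
  · rintro C ⟨i', hi', x', hx', rfl, hCk, hCZ, hlarge⟩
    obtain ⟨z, hz⟩ := exists_crit hh (hb i' hi')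
    have hle : #(lev (h i') (R i') z) ≤ k := by
      by_contra hcon
      have h1 := hlarge z hz.1 (by omega)
      have h2 : #(lev (h i') (R i') z \ W) ≤ #(lev (h i') (R i') z \ (W ∪ T)) + #T := by
        refine (card_le_card ?_).trans (card_union_le _ _)
        intro y; simp only [mem_sdiff, mem_union]; tauto
      have := hz.2.1
      omega
    have hsub : lev (h i') (R i') z ⊆ lev (h i') (R i') x' := lev_subset_of_card_le (by omega)
    have hsubT : lev (h i') (R i') z \ W ⊆ T := by
      intro y hy
      have := hCZ (hsub (mem_sdiff.1 hy).1)
      exact (mem_union.1 this).resolve_left (mem_sdiff.1 hy).2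
    have hF : Frag R h X W i₀ #(lev (h i') (R i') z) (lev (h i') (R i') z \ W) :=
      ⟨i', hi', z, hz, rfl, rfl, hsubT.trans hTR⟩
    have hkk : #(lev (h i') (R i') z) = k := le_antisymm hle (hkmin _ ⟨_, hF⟩)
    rw [hkk] at hF
    have := htmin _ hF
    have heq := eq_of_subset_of_card_le hsubT (by omega)
    rw [← heq]
    exact sdiff_subset.trans hsub

lemma sum_geom_bound {z : ℝ} (h0 : 0 ≤ z) (h1 : z ≤ 1 / 64) (n : ℕ) :
    ∑ t ∈ Icc 1 n, ∑ k ∈ range (2 * t + 1), (2 : ℝ) ^ k * z ^ t ≤ 9 * z := by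
  have h2 : ∀ t, ∑ k ∈ range (2 * t + 1), (2 : ℝ) ^ k * z ^ t ≤ 2 * (4 * z) ^ t := by
    intro t
    rw [← sum_mul, geom_sum_eq (by norm_num)]
    have : (2:ℝ) ^ (2 * t + 1) = 2 * 4 ^ t := by rw [pow_succ, pow_mul]; norm_num; ring
    rw [this, mul_pow]
    have := pow_nonneg h0 t
    have : (0:ℝ) ≤ 4 ^ t := by positivity
    nlinarith
  have h3 : ∑ t ∈ Icc 1 n, 2 * (4 * z) ^ t ≤ 9 * z - 9 * ((4 * z) ^ n * z) := by
    induction n with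
    | zero => simp
    | succ n ih =>
      rw [sum_Icc_succ_top (by omega)]
      have : 0 ≤ (4 * z) ^ n := by positivity
      rw [pow_succ]
      have h4 : 0 ≤ (4 * z) ^ n * z := mul_nonneg this h0
      nlinarith [mul_le_mul_of_nonneg_left h1 h4]
  exact (sum_le_sum fun t _ => h2 t).trans (h3.trans (by
    have : 0 ≤ (4 * z) ^ n * z := by positivity
    linarith))

lemma exists_fragment_family (hh : ∀ i x, 0 ≤ h i x) {p ε : ℝ} (hp : 0 < p) (hp1 : p ≤ 1)
    (hε : 0 ≤ ε) (hεp : 64 * ε ≤ p) :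
    ∃ 𝒯 : Finset V → Finset (Finset V),
      (∀ W, (∀ i ∈ X, ¬ Good (h i) (R i) W) → ∀ i ∈ X, ∃ T ∈ 𝒯 W, T ⊆ R i) ∧
      ∑ W, wt p W * ∑ T ∈ 𝒯 W, ε ^ #T ≤ 9 * (ε / p) := by
  classical
  set z := ε / p with hz
  have hz0 : 0 ≤ z := by positivity
  have hz1 : z ≤ 1 / 64 := by rw [hz, div_le_iff₀ hp]; linarith
  have hεz : ε = z * p := by rw [hz]; field_simp
  let Ch : Finset V → ℕ → ℕ → Finset V := fun Z k t =>
    if hC : ∃ C, Cand R h X Z k t C then hC.choose else ∅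
  let P : Finset V → ℕ → Finset V → Prop := fun W k T =>
    Disjoint T W ∧ 1 ≤ #T ∧ k ≤ 2 * #T ∧ T ⊆ Ch (W ∪ T) k #T
  have hCh : ∀ Z k t, #(Ch Z k t) ≤ k := by
    intro Z k t
    simp only [Ch]
    split_ifs with hC
    · obtain ⟨i, _, x, _, _, hk, _⟩ := hC.choose_spec
      exact hk.le
    · simp
  refine ⟨fun W => univ.filter fun T => ∃ k, P W k T, fun W hb i hi => ?_, ?_⟩
  · obtain ⟨k, T, hTR, hd, h1, h2, hex, hall⟩ := exists_fragment hh hb hi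
    refine ⟨T, mem_filter.2 ⟨mem_univ _, k, hd, h1, h2, ?_⟩, hTR⟩
    simp only [Ch]
    rw [dif_pos hex]
    exact hall _ hex.choose_spec
  · set n := Fintype.card V with hn
    have step1 : ∀ W, wt p W * ∑ T ∈ univ.filter (fun T => ∃ k, P W k T), ε ^ #T ≤
        ∑ T : Finset V, ∑ k ∈ range (2 * #T + 1),
          if P W k T then wt p (W ∪ T) * z ^ #T else 0 := by
      intro W
      rw [mul_sum, sum_filter]
      refine sum_le_sum fun T _ => ?_
      split_ifs with hP
      · obtain ⟨k, hk⟩ := hP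
        refine le_trans ?_ (single_le_sum (fun k _ => ?_) (mem_range.2 (by
          have := hk.2.2.1; omega : k < 2 * #T + 1)))
        · rw [if_pos hk, hεz, mul_pow]
          have h1 := wt_sdiff_mul hp.le hp1 (subset_union_right : T ⊆ W ∪ T)
          have h2 : (W ∪ T) \ T = W := by
            rw [union_sdiff_right]; exact sdiff_eq_self_of_disjoint hk.1.symm
          rw [h2] at h1
          have := mul_le_mul_of_nonneg_right h1 (pow_nonneg hz0 #T)
          linarith
        · split_ifs
          · exact mul_nonneg (wt_nonneg hp.le hp1 _) (pow_nonneg hz0 _)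
          · exact le_rfl
      · exact sum_nonneg fun k _ => by
          split_ifs
          · exact mul_nonneg (wt_nonneg hp.le hp1 _) (pow_nonneg hz0 _)
          · exact le_rfl
    refine (sum_le_sum fun W _ => step1 W).trans ?_
    rw [sum_comm]
    have step2 : ∀ T : Finset V, ∑ W, ∑ k ∈ range (2 * #T + 1),
          (if P W k T then wt p (W ∪ T) * z ^ #T else 0) ≤
        ∑ Z, ∑ k ∈ range (2 * #T + 1),
          if 1 ≤ #T ∧ T ⊆ Ch Z k #T then wt p Z * z ^ #T else 0 := by
      intro T
      have e : ∑ W, ∑ k ∈ range (2 * #T + 1),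
          (if P W k T then wt p (W ∪ T) * z ^ #T else 0) =
          ∑ W ∈ univ.filter (fun W => Disjoint T W), ∑ k ∈ range (2 * #T + 1),
          (if P W k T then wt p (W ∪ T) * z ^ #T else 0) := by
        rw [sum_filter]
        refine sum_congr rfl fun W _ => ?_
        split_ifs with hd
        · rfl
        · exact sum_eq_zero fun k _ => if_neg fun hP => hd hP.1
      rw [e]
      have hinj : Set.InjOn (fun W : Finset V => W ∪ T)
          (univ.filter (fun W => Disjoint T W) : Finset (Finset V)) := by
        intro W hW W' hW' heq
        simp only [coe_filter, mem_univ, true_and, Set.mem_ofPred_eq] at hW hW' heq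
        have := congrArg (· \ T) heq
        simpa [union_sdiff_right, sdiff_eq_self_of_disjoint hW.symm,
          sdiff_eq_self_of_disjoint hW'.symm] using this
      have hnn : ∀ Z : Finset V, 0 ≤ wt p Z * z ^ #T := fun Z =>
        mul_nonneg (wt_nonneg hp.le hp1 _) (pow_nonneg hz0 _)
      calc _ ≤ ∑ W ∈ univ.filter (fun W => Disjoint T W), ∑ k ∈ range (2 * #T + 1),
            (if 1 ≤ #T ∧ T ⊆ Ch (W ∪ T) k #T then wt p (W ∪ T) * z ^ #T else 0) := by
            refine sum_le_sum fun W _ => sum_le_sum fun k _ => ?_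
            by_cases hP : P W k T
            · rw [if_pos hP, if_pos ⟨hP.2.1, hP.2.2.2⟩]
            · rw [if_neg hP]; split_ifs
              · exact hnn _
              · exact le_rfl
        _ = ∑ Z ∈ (univ.filter (fun W => Disjoint T W)).image (fun W => W ∪ T),
            ∑ k ∈ range (2 * #T + 1),
            (if 1 ≤ #T ∧ T ⊆ Ch Z k #T then wt p Z * z ^ #T else 0) := by
            rw [sum_image hinj]
        _ ≤ _ := by
            refine sum_le_sum_of_subset_of_nonneg (subset_univ _) fun Z _ _ =>
              sum_nonneg fun k _ => ?_
            split_ifs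
            · exact hnn _
            · exact le_rfl
    refine (sum_le_sum fun T _ => step2 T).trans ?_
    rw [sum_comm]
    have step3 : ∀ Z : Finset V, ∑ T : Finset V, ∑ k ∈ range (2 * #T + 1),
          (if 1 ≤ #T ∧ T ⊆ Ch Z k #T then wt p Z * z ^ #T else 0) ≤ wt p Z * (9 * z) := by
      intro Z
      refine le_trans ?_ (mul_le_mul_of_nonneg_left (sum_geom_bound hz0 hz1 n)
        (wt_nonneg hp.le hp1 Z))
      have hmaps : ∀ T ∈ (univ : Finset (Finset V)).filter (fun T => 1 ≤ #T), #T ∈ Icc 1 n :=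
        fun T hT => mem_Icc.2 ⟨(mem_filter.1 hT).2, card_le_univ T⟩
      have e : ∑ T : Finset V, ∑ k ∈ range (2 * #T + 1),
          (if 1 ≤ #T ∧ T ⊆ Ch Z k #T then wt p Z * z ^ #T else 0) =
          ∑ T ∈ (univ : Finset (Finset V)).filter (fun T => 1 ≤ #T),
            ∑ k ∈ range (2 * #T + 1), (if T ⊆ Ch Z k #T then wt p Z * z ^ #T else 0) := by
        rw [sum_filter]
        refine sum_congr rfl fun T _ => ?_
        split_ifs with h1 <;> simp [h1]
      rw [e, ← sum_fiberwise_of_maps_to hmaps, mul_sum]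
      refine sum_le_sum fun t _ => ?_
      calc _ = ∑ T ∈ ((univ : Finset (Finset V)).filter (fun T => 1 ≤ #T)).filter (fun T => #T = t),
            ∑ k ∈ range (2 * t + 1), (if T ⊆ Ch Z k t then wt p Z * z ^ t else 0) := by
            refine sum_congr rfl fun T hT => ?_
            rw [(mem_filter.1 hT).2]
        _ ≤ ∑ T : Finset V, ∑ k ∈ range (2 * t + 1),
              (if T ⊆ Ch Z k t then wt p Z * z ^ t else 0) := by
            refine sum_le_sum_of_subset_of_nonneg (subset_univ _) fun T _ _ =>
              sum_nonneg fun k _ => ?_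
            split_ifs
            · exact mul_nonneg (wt_nonneg hp.le hp1 _) (pow_nonneg hz0 _)
            · exact le_rfl
        _ ≤ _ := by
            rw [sum_comm, mul_sum]
            refine sum_le_sum fun k _ => ?_
            have : (univ : Finset (Finset V)).filter (fun T => T ⊆ Ch Z k t) =
                (Ch Z k t).powerset := by ext; simp
            rw [← sum_filter, this, sum_const, card_powerset, nsmul_eq_mul]
            push_cast
            have h2 : (2:ℝ) ^ #(Ch Z k t) ≤ 2 ^ k := pow_le_pow_right₀ (by norm_num) (hCh Z k t)
            have h3 : 0 ≤ wt p Z * z ^ t := mul_nonneg (wt_nonneg hp.le hp1 _) (pow_nonneg hz0 _)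
            nlinarith [mul_le_mul_of_nonneg_right h2 h3]
    refine (sum_le_sum fun Z _ => step3 Z).trans ?_
    rw [← sum_mul, sum_wt, one_mul]

/-- A weighted spread family is mostly good. -/
lemma bad_mul_mass_le (hh : ∀ i x, 0 ≤ h i x) {p ε : ℝ} (hp : 0 < p) (hp1 : p ≤ 1)
    (hε : 0 ≤ ε) (hεp : 64 * ε ≤ p) {ν : ι → ℝ} (hν : ∀ i, 0 ≤ ν i)
    (hs : ∀ I : Finset V, ∑ i ∈ X with I ⊆ R i, ν i ≤ ε ^ #I) (b : Finset V → ℝ)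
    (hb1 : ∀ W, b W ≤ 1) (hb : ∀ W, ∀ i ∈ X, Good (h i) (R i) W → b W ≤ 0) :
    (∑ W, wt p W * b W) * ∑ i ∈ X, ν i ≤ 9 * (ε / p) := by
  classical
  obtain ⟨𝒯, h1, h2⟩ := exists_fragment_family (R := R) (X := X) hh hp hp1 hε hεp
  refine le_trans ?_ h2
  rw [sum_mul]
  refine sum_le_sum fun W _ => ?_
  rw [mul_assoc]
  refine mul_le_mul_of_nonneg_left ?_ (wt_nonneg hp.le hp1 W)
  have hpos : 0 ≤ ∑ T ∈ 𝒯 W, ε ^ #T := sum_nonneg fun T _ => pow_nonneg hε _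
  have hν' : 0 ≤ ∑ i ∈ X, ν i := sum_nonneg fun i _ => hν i
  by_cases hbad : ∀ i ∈ X, ¬ Good (h i) (R i) W
  · calc b W * ∑ i ∈ X, ν i ≤ 1 * ∑ i ∈ X, ν i := mul_le_mul_of_nonneg_right (hb1 W) hν'
      _ = ∑ i ∈ X, ν i := one_mul _
      _ ≤ ∑ i ∈ X, ∑ T ∈ 𝒯 W, if T ⊆ R i then ν i else 0 := by
          refine sum_le_sum fun i hi => ?_
          obtain ⟨T, hT, hTR⟩ := h1 W hbad i hi
          refine le_trans ?_ (single_le_sum (fun T _ => ?_) hT)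
          · rw [if_pos hTR]
          · split_ifs
            · exact hν i
            · exact le_rfl
      _ = ∑ T ∈ 𝒯 W, ∑ i ∈ X with T ⊆ R i, ν i := by
          rw [sum_comm]; exact sum_congr rfl fun T _ => (sum_filter _ _).symm
      _ ≤ _ := sum_le_sum fun T _ => hs T
  · push Not at hbad
    obtain ⟨i, hi, hg⟩ := hbad
    exact (mul_nonpos_of_nonpos_of_nonneg (hb W i hi hg) hν').trans hpos

/-- A family that is not small is mostly good. -/
lemma bad_le_of_not_small (hh : ∀ i x, 0 ≤ h i x) {p ε : ℝ} (hp : 0 < p) (hp1 : p ≤ 1)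
    (hε : 0 ≤ ε) (hεp : 64 * ε ≤ p)
    (hs : ∀ 𝒯 : Finset (Finset V), (∀ i ∈ X, ∃ T ∈ 𝒯, T ⊆ R i) → 1 / 2 ≤ ∑ T ∈ 𝒯, ε ^ #T)
    (b : Finset V → ℝ)
    (hb1 : ∀ W, b W ≤ 1) (hb : ∀ W, ∀ i ∈ X, Good (h i) (R i) W → b W ≤ 0) :
    ∑ W, wt p W * b W ≤ 18 * (ε / p) := by
  obtain ⟨𝒯, h1, h2⟩ := exists_fragment_family (R := R) (X := X) hh hp hp1 hε hεp
  have : (∑ W, wt p W * b W) ≤ 2 * ∑ W, wt p W * ∑ T ∈ 𝒯 W, ε ^ #T := by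
    rw [mul_sum]
    refine sum_le_sum fun W _ => ?_
    have hw := wt_nonneg hp.le hp1 W
    by_cases hbad : ∀ i ∈ X, ¬ Good (h i) (R i) W
    · have := hs _ (h1 W hbad)
      nlinarith [hb1 W]
    · push Not at hbad
      obtain ⟨i, hi, hg⟩ := hbad
      have hpos : 0 ≤ ∑ T ∈ 𝒯 W, ε ^ #T := sum_nonneg fun T _ => pow_nonneg hε _
      have := hb W i hi hg
      nlinarith
  linarith

end Fragments

section PrekopaLeindler

open MeasureTheory ProbabilityTheory
open scoped ENNReal

/-- One-dimensional Brunn–Minkowski inequality for midpoints. -/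
lemma volume_add_le_two_mul_midpoint {A B C : Set ℝ} (hA : MeasurableSet A) (hB : MeasurableSet B)
    (hAn : A.Nonempty) (hBn : B.Nonempty) (hC : ∀ x ∈ A, ∀ y ∈ B, (x + y) / 2 ∈ C) :
    volume A + volume B ≤ 2 * volume C := by
  have hC2 : volume ((fun z => (1 / 2 : ℝ) * z) ⁻¹' C) = 2 * volume C := by
    rw [Real.volume_preimage_mul_left (by norm_num)]
    norm_num
  have key : ∀ K K' : Set ℝ, K ⊆ A → IsCompact K → K' ⊆ B → IsCompact K' →
      volume K + volume K' ≤ 2 * volume C := by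
    intro K₀ K₀' hK₀ hK₀c hK₀' hK₀c'
    obtain ⟨a₀, ha₀⟩ := hAn
    obtain ⟨b₀, hb₀⟩ := hBn
    have hKc : IsCompact (insert a₀ K₀) := hK₀c.insert a₀
    have hKc' : IsCompact (insert b₀ K₀') := hK₀c'.insert b₀
    have hKA : insert a₀ K₀ ⊆ A := Set.insert_subset ha₀ hK₀
    have hKB : insert b₀ K₀' ⊆ B := Set.insert_subset hb₀ hK₀'
    refine (add_le_add (measure_mono (Set.subset_insert a₀ K₀))
      (measure_mono (Set.subset_insert b₀ K₀'))).trans ?_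
    have hne : (insert a₀ K₀).Nonempty := Set.insert_nonempty _ _
    have hne' : (insert b₀ K₀').Nonempty := Set.insert_nonempty _ _
    generalize insert a₀ K₀ = K at *
    generalize insert b₀ K₀' = K' at *
    obtain ⟨a, haK, ha⟩ := hKc.exists_isGreatest hne
    obtain ⟨b, hbK, hb⟩ := hKc'.exists_isLeast hne'
    have e1 : volume ((fun z => z + (-b)) ⁻¹' K) = volume K := measure_preimage_add_right _ _ _
    have e2 : volume ((fun z => (-a) + z) ⁻¹' K') = volume K' := measure_preimage_add _ _ _
    rw [← e1, ← e2, ← hC2, ← measure_union_add_inter]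
    · have hz : volume (((fun z => z + (-b)) ⁻¹' K) ∩ ((fun z => (-a) + z) ⁻¹' K')) = 0 := by
        refine measure_mono_null (t := {a + b}) ?_ (by simp)
        rintro z ⟨h1, h2⟩
        have h3 : z + -b ≤ a := ha h1
        have h4 : b ≤ -a + z := hb h2
        simp only [Set.mem_singleton_iff]; linarith
      rw [hz, add_zero]
      refine measure_mono ?_
      rintro z (h1 | h2)
      · have := hC _ (hKA h1) _ (hKB hbK)
        have e : (1 / 2 : ℝ) * z = (z + -b + b) / 2 := by ring
        simpa only [Set.mem_preimage, e] using this
      · have := hC _ (hKA haK) _ (hKB h2)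
        have e : (1 / 2 : ℝ) * z = (a + (-a + z)) / 2 := by ring
        simpa only [Set.mem_preimage, e] using this
    · exact (measurable_const_add (-a)) hKc'.measurableSet
  rw [hA.measure_eq_iSup_isCompact, hB.measure_eq_iSup_isCompact]
  simp only [iSup_and']
  exact ENNReal.biSup_add_biSup_le' ⟨∅, Set.empty_subset _, isCompact_empty⟩
    ⟨∅, Set.empty_subset _, isCompact_empty⟩ fun K hK K' hK' => key K K' hK.1 hK.2 hK'.1 hK'.2

lemma lintegral_add_le_two_mul_of_sup {f g h : ℝ → ℝ} (hf : Measurable f) (hg : Measurable g)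
    (hh : Measurable h) (f0 : ∀ x, 0 ≤ f x) (g0 : ∀ x, 0 ≤ g x) (h0 : ∀ x, 0 ≤ h x)
    (f1 : ∀ x, f x ≤ 1) (g1 : ∀ x, g x ≤ 1) (fs : ∀ r < 1, ∃ x, r < f x)
    (gs : ∀ r < 1, ∃ x, r < g x) (H : ∀ x y, f x * g y ≤ h ((x + y) / 2) ^ 2) :
    (∫⁻ x, ENNReal.ofReal (f x)) + ∫⁻ x, ENNReal.ofReal (g x) ≤
      2 * ∫⁻ x, ENNReal.ofReal (h x) := by
  rw [lintegral_eq_lintegral_meas_lt _ (ae_of_all _ f0) hf.aemeasurable,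
    lintegral_eq_lintegral_meas_lt _ (ae_of_all _ g0) hg.aemeasurable,
    lintegral_eq_lintegral_meas_lt _ (ae_of_all _ h0) hh.aemeasurable]
  have hanti : ∀ u : ℝ → ℝ, Measurable fun t => volume {a | t < u a} := fun u =>
    Antitone.measurable fun s t hst => measure_mono fun a (ha : t < u a) => hst.trans_lt ha
  rw [← lintegral_add_left (hanti f), ← lintegral_const_mul _ (hanti h)]
  refine setLIntegral_mono ((hanti h).const_mul _) fun t ht => ?_
  have ht0 : 0 < t := ht
  by_cases ht1 : t < 1
  · refine volume_add_le_two_mul_midpoint (measurableSet_lt measurable_const hf)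
      (measurableSet_lt measurable_const hg) (fs t ht1) (gs t ht1) fun x hx y hy => ?_
    have hx' : t < f x := hx
    have hy' : t < g y := hy
    have := H x y
    have h3 := h0 ((x + y) / 2)
    have : t * t < h ((x + y) / 2) ^ 2 := lt_of_lt_of_le (mul_lt_mul'' hx' hy' ht0.le ht0.le) this
    show t < h ((x + y) / 2)
    nlinarith
  · have e1 : {a | t < f a} = ∅ := by
      ext a; simp only [Set.mem_ofPred_eq, Set.mem_empty_iff_false, iff_false, not_lt]
      linarith [f1 a, not_lt.1 ht1]
    have e2 : {a | t < g a} = ∅ := by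
      ext a; simp only [Set.mem_ofPred_eq, Set.mem_empty_iff_false, iff_false, not_lt]
      linarith [g1 a, not_lt.1 ht1]
    simp [e1, e2]

lemma four_mul_mul_le_sq (x y : ℝ≥0∞) : 4 * (x * y) ≤ (x + y) ^ 2 := by
  by_cases hx : x = ⊤
  · simp [hx]
  by_cases hy : y = ⊤
  · simp [hy]
  lift x to NNReal using hx
  lift y to NNReal using hy
  have : 4 * (x * y) ≤ (x + y) ^ 2 := by
    rw [← NNReal.coe_le_coe]; push_cast; nlinarith [sq_nonneg ((x:ℝ) - y)]
  exact_mod_cast this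

lemma exists_lt_toReal_div_iSup {f : ℝ → ℝ≥0∞} (h0 : (⨆ x, f x) ≠ 0) (ht : (⨆ x, f x) ≠ ⊤)
    {r : ℝ} (hr : r < 1) : ∃ x, r < (f x / ⨆ x, f x).toReal := by
  rcases lt_or_ge r 0 with hr0 | hr0
  · exact ⟨0, hr0.trans_le ENNReal.toReal_nonneg⟩
  have : ENNReal.ofReal r * (⨆ x, f x) < ⨆ x, f x := by
    calc ENNReal.ofReal r * (⨆ x, f x) < 1 * (⨆ x, f x) :=
          ENNReal.mul_lt_mul_left h0 ht (by simpa using hr)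
      _ = _ := one_mul _
  obtain ⟨x, hx⟩ := lt_iSup_iff.1 this
  refine ⟨x, (ENNReal.ofReal_lt_iff_lt_toReal hr0 ?_).1 ?_⟩
  · exact ENNReal.div_ne_top (ne_top_of_le_ne_top ht (le_iSup f x)) h0
  · exact (ENNReal.lt_div_iff_mul_lt (Or.inl h0) (Or.inl ht)).2 hx

lemma prekopaLeindler_bounded {f g h : ℝ → ℝ≥0∞} (hf : Measurable f) (hg : Measurable g)
    (hh : Measurable h) {M : ℝ≥0∞} (hM : M ≠ ⊤) (fM : ∀ x, f x ≤ M) (gM : ∀ x, g x ≤ M)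
    (H : ∀ x y, f x * g y ≤ h ((x + y) / 2) ^ 2) :
    (∫⁻ x, f x) * ∫⁻ x, g x ≤ (∫⁻ x, h x) ^ 2 := by
  set a := ⨆ x, f x with ha
  set b := ⨆ x, g x with hb
  have hale : a ≤ M := iSup_le fM
  have hble : b ≤ M := iSup_le gM
  have fa : ∀ x, f x ≤ a := le_iSup f
  have gb : ∀ x, g x ≤ b := le_iSup g
  have hat : a ≠ ⊤ := ne_top_of_le_ne_top hM hale
  have hbt : b ≠ ⊤ := ne_top_of_le_ne_top hM hble
  by_cases ha0 : a = 0
  · have : ∀ x, f x = 0 := fun x => le_zero_iff.1 (ha0 ▸ fa x)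
    simp [this]
  by_cases hb0 : b = 0
  · have : ∀ x, g x = 0 := fun x => le_zero_iff.1 (hb0 ▸ gb x)
    simp [this]
  clear_value a b
  set c : ℝ≥0∞ := (a * b) ^ (1 / 2 : ℝ) with hc
  have hc2 : c ^ 2 = a * b := by
    rw [hc, ← ENNReal.rpow_natCast, ← ENNReal.rpow_mul]; norm_num
  have hab0 : a * b ≠ 0 := mul_ne_zero ha0 hb0
  have habt : a * b ≠ ⊤ := ENNReal.mul_ne_top hat hbt
  have hc0 : c ≠ 0 := by rintro h0; rw [h0] at hc2; simp at hc2; tauto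
  have hct : c ≠ ⊤ := by rintro h0; rw [h0] at hc2; simp at hc2; exact habt hc2.symm
  have fle : ∀ x, f x / a ≤ 1 := fun x => ENNReal.div_le_of_le_mul (by rw [one_mul]; exact fa x)
  have gle : ∀ x, g x / b ≤ 1 := fun x => ENNReal.div_le_of_le_mul (by rw [one_mul]; exact gb x)
  have main := lintegral_add_le_two_mul_of_sup (f := fun x => (f x / a).toReal)
    (g := fun x => (g x / b).toReal) (h := fun x => (min (h x / c) 1).toReal)
    (hf.div_const _).ennreal_toReal (hg.div_const _).ennreal_toReal
    ((hh.div_const _).min measurable_const).ennreal_toReal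
    (fun _ => ENNReal.toReal_nonneg) (fun _ => ENNReal.toReal_nonneg)
    (fun _ => ENNReal.toReal_nonneg)
    (fun x => ENNReal.toReal_le_of_le_ofReal zero_le_one (by simpa using fle x))
    (fun x => ENNReal.toReal_le_of_le_ofReal zero_le_one (by simpa using gle x))
    (fun r hr => by rw [ha] at ha0 hat ⊢; exact exists_lt_toReal_div_iSup ha0 hat hr)
    (fun r hr => by rw [hb] at hb0 hbt ⊢; exact exists_lt_toReal_div_iSup hb0 hbt hr)
    (fun x y => by
      rw [← ENNReal.toReal_mul, ← ENNReal.toReal_pow]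
      refine ENNReal.toReal_mono (ENNReal.pow_ne_top (by simp)) ?_
      rcases le_total (h ((x + y) / 2) / c) 1 with h1 | h1
      · rw [min_eq_left h1, ← ENNReal.mul_div_mul_comm (Or.inl ha0) (Or.inl hat), ← hc2,
          div_eq_mul_inv, div_eq_mul_inv, mul_pow, ENNReal.inv_pow]
        exact mul_le_mul_left (H x y) _
      · rw [min_eq_right h1, one_pow]
        exact mul_le_one' (fle x) (gle y))
  have cf : ∀ x, ENNReal.ofReal (f x / a).toReal = f x / a := fun x =>
    ENNReal.ofReal_toReal (ENNReal.div_ne_top (ne_top_of_le_ne_top hat (fa x)) ha0)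
  have cg : ∀ x, ENNReal.ofReal (g x / b).toReal = g x / b := fun x =>
    ENNReal.ofReal_toReal (ENNReal.div_ne_top (ne_top_of_le_ne_top hbt (gb x)) hb0)
  have ch : ∀ x, ENNReal.ofReal (min (h x / c) 1).toReal ≤ h x / c := fun x =>
    ENNReal.ofReal_toReal_le.trans (min_le_left _ _)
  simp only [cf, cg] at main
  have main' := main.trans (mul_le_mul_right (lintegral_mono ch) 2)
  simp only [div_eq_mul_inv] at main'
  rw [lintegral_mul_const _ hf, lintegral_mul_const _ hg, lintegral_mul_const _ hh] at main'
  have h4 := (four_mul_mul_le_sq _ _).trans (pow_le_pow_left' main' 2)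
  have e1 : ∀ F G : ℝ≥0∞, 4 * (F * a⁻¹ * (G * b⁻¹)) * (a * b) = 4 * (F * G) := by
    intro F G
    calc _ = 4 * (F * G) * (a⁻¹ * a) * (b⁻¹ * b) := by ring
      _ = _ := by rw [ENNReal.inv_mul_cancel ha0 hat, ENNReal.inv_mul_cancel hb0 hbt]; ring
  have e2 : ∀ F : ℝ≥0∞, (2 * (F * c⁻¹)) ^ 2 * (a * b) = 4 * F ^ 2 := by
    intro F
    rw [← hc2]
    calc _ = 4 * F ^ 2 * (c⁻¹ * c) ^ 2 := by ring
      _ = _ := by rw [ENNReal.inv_mul_cancel hc0 hct]; ring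
  have h5 := mul_le_mul_left h4 (a * b)
  rw [e1, e2] at h5
  exact (ENNReal.mul_le_mul_iff_right (by norm_num) (by norm_num)).1 h5

/-- The Prékopa–Leindler inequality on the line, for midpoints. -/
lemma prekopaLeindler_real {f g h : ℝ → ℝ≥0∞} (hf : Measurable f) (hg : Measurable g)
    (hh : Measurable h) (H : ∀ x y, f x * g y ≤ h ((x + y) / 2) ^ 2) :
    (∫⁻ x, f x) * ∫⁻ x, g x ≤ (∫⁻ x, h x) ^ 2 := by
  have tr : ∀ u : ℝ → ℝ≥0∞, Measurable u →
      ∫⁻ x, u x = ⨆ n : ℕ, ∫⁻ x, min (u x) n := by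
    intro u hu
    rw [← lintegral_iSup (fun n => hu.min measurable_const)
      (fun m n hmn x => min_le_min le_rfl (by exact_mod_cast hmn))]
    refine lintegral_congr fun x => ?_
    rw [← inf_iSup_eq, ENNReal.iSup_natCast, inf_top_eq]
  rw [tr f hf, tr g hg, ENNReal.iSup_mul]
  refine iSup_le fun m => ?_
  rw [ENNReal.mul_iSup]
  refine iSup_le fun n => ?_
  refine prekopaLeindler_bounded (hf.min measurable_const) (hg.min measurable_const) hh
    (M := m + n) (by finiteness) (fun x => (min_le_right _ _).trans le_self_add)
    (fun x => (min_le_right _ _).trans le_add_self) fun x y => ?_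
  exact (mul_le_mul' (min_le_left _ _) (min_le_left _ _)).trans (H x y)

/-- The Prékopa–Leindler inequality for the standard Gaussian on the line, with its strong
log-concavity gain. -/
lemma prekopaLeindler_gaussianReal {f g h : ℝ → ℝ≥0∞} (hf : Measurable f) (hg : Measurable g)
    (hh : Measurable h) (H : ∀ x y, f x * g y * ENNReal.ofReal (Real.exp (-((x - y) ^ 2 / 4)))
      ≤ h ((x + y) / 2) ^ 2) :
    (∫⁻ x, f x ∂gaussianReal 0 1) * ∫⁻ x, g x ∂gaussianReal 0 1 ≤
      (∫⁻ x, h x ∂gaussianReal 0 1) ^ 2 := by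
  rw [gaussianReal_of_var_ne_zero 0 one_ne_zero,
    lintegral_withDensity_eq_lintegral_mul _ (measurable_gaussianPDF 0 1) hf,
    lintegral_withDensity_eq_lintegral_mul _ (measurable_gaussianPDF 0 1) hg,
    lintegral_withDensity_eq_lintegral_mul _ (measurable_gaussianPDF 0 1) hh]
  refine prekopaLeindler_real ((measurable_gaussianPDF 0 1).mul hf)
    ((measurable_gaussianPDF 0 1).mul hg) ((measurable_gaussianPDF 0 1).mul hh) fun x y => ?_
  simp only [Pi.mul_apply]
  have key : gaussianPDF 0 1 x * gaussianPDF 0 1 y = gaussianPDF 0 1 ((x + y) / 2) ^ 2 *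
      ENNReal.ofReal (Real.exp (-((x - y) ^ 2 / 4))) := by
    simp only [gaussianPDF]
    rw [← ENNReal.ofReal_mul (gaussianPDFReal_nonneg _ _ _),
      ← ENNReal.ofReal_pow (gaussianPDFReal_nonneg _ _ _),
      ← ENNReal.ofReal_mul (pow_nonneg (gaussianPDFReal_nonneg _ _ _) 2)]
    congr 1
    simp only [gaussianPDFReal]
    rw [mul_mul_mul_comm, ← Real.exp_add, mul_pow, mul_assoc (_ ^ 2), sq (Real.exp _),
      ← Real.exp_add, ← Real.exp_add, ← sq]
    congr 2
    simp only [NNReal.coe_one]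
    ring
  calc _ = gaussianPDF 0 1 x * gaussianPDF 0 1 y * (f x * g y) := by ring
    _ = gaussianPDF 0 1 ((x + y) / 2) ^ 2 *
        (f x * g y * ENNReal.ofReal (Real.exp (-((x - y) ^ 2 / 4)))) := by rw [key]; ring
    _ ≤ gaussianPDF 0 1 ((x + y) / 2) ^ 2 * h ((x + y) / 2) ^ 2 := mul_le_mul_right (H x y) _
    _ = _ := by rw [mul_pow]

/-- The standard Gaussian measure on `ℝⁿ`. -/
noncomputable abbrev gauss (n : ℕ) : Measure (Fin n → ℝ) :=
  Measure.pi fun _ => gaussianReal 0 1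

lemma lintegral_gauss_succ (n : ℕ) {f : (Fin (n + 1) → ℝ) → ℝ≥0∞} (hf : Measurable f) :
    ∫⁻ x, f x ∂gauss (n + 1) =
      ∫⁻ a, ∫⁻ x, f (Fin.cons a x) ∂gauss n ∂gaussianReal 0 1 := by
  have hmp := measurePreserving_piFinSuccAbove (n := n) (fun _ => gaussianReal 0 1) 0
  have hf' : Measurable (f ∘ (MeasurableEquiv.piFinSuccAbove (fun _ => ℝ) (0 : Fin (n+1))).symm) :=
    hf.comp (MeasurableEquiv.measurable _)
  have := hmp.lintegral_comp hf'
  simp only [Function.comp_apply, MeasurableEquiv.symm_apply_apply] at this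
  rw [this]
  refine (lintegral_prod _ hf'.aemeasurable).trans ?_
  refine lintegral_congr fun a => lintegral_congr fun x => ?_
  simp only [Function.comp_apply]
  congr 1
  rw [MeasurableEquiv.symm_apply_eq]
  ext i
  · simp [MeasurableEquiv.piFinSuccAbove]
  · simp [MeasurableEquiv.piFinSuccAbove]

lemma measurable_cons (n : ℕ) :
    Measurable fun z : ℝ × (Fin n → ℝ) => (Fin.cons z.1 z.2 : Fin (n + 1) → ℝ) := by
  refine measurable_pi_iff.2 fun i => ?_
  refine Fin.cases ?_ (fun j => ?_) i
  · simpa using measurable_fst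
  · simp only [Fin.cons_succ]
    fun_prop

/-- The Prékopa–Leindler inequality for the standard Gaussian measure, with its strong
log-concavity gain. -/
theorem prekopaLeindler_gauss (n : ℕ) : ∀ {f g h : (Fin n → ℝ) → ℝ≥0∞}, Measurable f →
    Measurable g → Measurable h →
    (∀ x y, f x * g y * ENNReal.ofReal (Real.exp (-(∑ i, (x i - y i) ^ 2 / 4)))
      ≤ h (fun i => (x i + y i) / 2) ^ 2) →
    (∫⁻ x, f x ∂gauss n) * ∫⁻ x, g x ∂gauss n ≤ (∫⁻ x, h x ∂gauss n) ^ 2 := by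
  induction n with
  | zero =>
    intro f g h _ _ _ H
    have := H default default
    simp only [univ_eq_empty, sum_empty, neg_zero, Real.exp_zero, ENNReal.ofReal_one,
      mul_one] at this
    have e : (fun i => ((default : Fin 0 → ℝ) i + (default : Fin 0 → ℝ) i) / 2) = default :=
      Subsingleton.elim _ _
    rw [e] at this
    have e2 : ∀ u : (Fin 0 → ℝ) → ℝ≥0∞, ∫⁻ x, u x ∂gauss 0 = u default := fun u => by
      rw [lintegral_unique, measure_univ, mul_one]
      exact congrArg u (Subsingleton.elim _ _)
    rw [e2, e2, e2]
    exact this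
  | succ n ih =>
    intro f g h hf hg hh H
    rw [lintegral_gauss_succ n hf, lintegral_gauss_succ n hg, lintegral_gauss_succ n hh]
    have hm : ∀ u : (Fin (n + 1) → ℝ) → ℝ≥0∞, Measurable u →
        Measurable fun a : ℝ => ∫⁻ x, u (Fin.cons a x) ∂gauss n := fun u hu =>
      Measurable.lintegral_prod_right' (hu.comp (measurable_cons n))
    have hs : ∀ (u : (Fin (n + 1) → ℝ) → ℝ≥0∞) (a : ℝ), Measurable u →
        Measurable fun x : Fin n → ℝ => u (Fin.cons a x) := fun u a hu =>
      hu.comp ((measurable_cons n).comp measurable_prodMk_left)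
    refine prekopaLeindler_gaussianReal (hm f hf) (hm g hg) (hm h hh) fun a b => ?_
    rw [mul_right_comm, ← lintegral_mul_const _ (hs f a hf)]
    refine ih ((hs f a hf).mul_const _) (hs g b hg) (hs h _ hh) fun x y => ?_
    have := H (Fin.cons a x) (Fin.cons b y)
    have e : (fun i => ((Fin.cons a x : Fin (n + 1) → ℝ) i + (Fin.cons b y : Fin (n + 1) → ℝ) i) / 2) =
        Fin.cons ((a + b) / 2) fun i => (x i + y i) / 2 := by
      ext i
      refine Fin.cases ?_ (fun j => ?_) i <;> simp
    rw [e, Fin.sum_univ_succ] at this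
    simp only [Fin.cons_zero, Fin.cons_succ, neg_add, Real.exp_add] at this
    rw [ENNReal.ofReal_mul (Real.exp_nonneg _)] at this
    refine le_trans (le_of_eq ?_) this
    ring

end PrekopaLeindler

section GaussianFacts

open MeasureTheory ProbabilityTheory

/-- The standard Gaussian tail `P(g > c)`. -/
noncomputable def tail (c : ℝ) : ℝ := (gaussianReal 0 1).real (Set.Ioi c)

lemma tail_nonneg (c : ℝ) : 0 ≤ tail c := measureReal_nonneg

lemma tail_le_one (c : ℝ) : tail c ≤ 1 := measureReal_le_one

lemma tail_le {c : ℝ} (hc : 0 ≤ c) : tail c ≤ Real.exp (-(c ^ 2 / 2)) := by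
  have h1 := measure_ge_le_exp_mul_mgf (μ := gaussianReal 0 1) (X := id) (t := c) c hc
    (integrable_exp_mul_gaussianReal c)
  rw [mgf_id_gaussianReal, ← Real.exp_add] at h1
  have h2 : tail c ≤ (gaussianReal 0 1).real {ω | c ≤ id ω} :=
    measureReal_mono fun x (hx : c < x) => hx.le
  refine h2.trans (h1.trans_eq ?_)
  congr 1
  simp only [NNReal.coe_one]; ring

lemma le_tail {s : ℝ} (hs : 0 ≤ s) : Real.exp (-((s + 1) ^ 2 / 2) - 1) ≤ tail s := by
  have h1 : (gaussianReal 0 1).real (Set.Ioc s (s + 1)) ≤ tail s :=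
    measureReal_mono fun x hx => hx.1
  refine le_trans ?_ h1
  rw [measureReal_def, gaussianReal_apply_eq_integral 0 one_ne_zero, ENNReal.toReal_ofReal
    (integral_nonneg fun x => gaussianPDFReal_nonneg _ _ _)]
  have h2 : ∫ _x in Set.Ioc s (s + 1), Real.exp (-((s + 1) ^ 2 / 2) - 1) ≤
      ∫ x in Set.Ioc s (s + 1), gaussianPDFReal 0 1 x := by
    refine setIntegral_mono_on (integrable_const _)
      (integrable_gaussianPDFReal 0 1).integrableOn measurableSet_Ioc fun x hx => ?_
    rw [gaussianPDFReal]
    simp only [NNReal.coe_one, mul_one, sub_zero]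
    have h3 : Real.exp (-1) ≤ (Real.sqrt (2 * Real.pi))⁻¹ := by
      rw [Real.exp_neg]
      refine inv_anti₀ (Real.sqrt_pos.2 (by positivity)) ?_
      rw [Real.sqrt_le_left (Real.exp_nonneg _)]
      have := Real.exp_one_gt_d9
      have := Real.pi_lt_d2
      nlinarith
    rw [sub_eq_add_neg, Real.exp_add, mul_comm]
    refine mul_le_mul h3 (Real.exp_le_exp.2 ?_) (Real.exp_nonneg _) (by positivity)
    have := hx.1; have := hx.2
    nlinarith
  refine le_trans (le_of_eq ?_) h2
  simp

lemma integral_Iic_id_ge (s : ℝ) :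
    -1 ≤ ∫ u, (Set.Iic s).indicator 1 u * u ∂gaussianReal 0 1 := by
  have hsq : Integrable (fun x : ℝ => x ^ 2) (gaussianReal 0 1) :=
    (memLp_id_gaussianReal (μ := 0) (v := 1) 2).integrable_sq
  have hid : Integrable (fun x : ℝ => x) (gaussianReal 0 1) :=
    (memLp_id_gaussianReal (μ := 0) (v := 1) 1).integrable (by simp)
  have hv : ∫ x, x ^ 2 ∂gaussianReal 0 1 = 1 := by
    have := variance_eq_integral (μ := gaussianReal 0 1) (X := id) measurable_id.aemeasurable
    rw [variance_id_gaussianReal] at this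
    simp only [id, integral_id_gaussianReal, sub_zero, NNReal.coe_one] at this
    exact this.symm
  have h1 : ∫ u, -((1 + u ^ 2) / 2) ∂gaussianReal 0 1 = -1 := by
    rw [integral_neg, integral_div, integral_add (integrable_const _) hsq, hv]
    simp
  rw [← h1]
  refine integral_mono (((integrable_const _).add hsq).div_const 2).neg ?_ fun u => ?_
  · have : (fun u : ℝ => (Set.Iic s).indicator 1 u * u) = (Set.Iic s).indicator fun u => u := by
      ext u; by_cases hu : u ∈ Set.Iic s <;> simp [hu]
    rw [this]
    exact hid.indicator measurableSet_Iic
  · by_cases hu : u ∈ Set.Iic s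
    · simp only [Set.indicator_of_mem hu, Pi.one_apply, one_mul]
      nlinarith [sq_nonneg (u + 1)]
    · simp only [Set.indicator_of_notMem hu, zero_mul]
      nlinarith [sq_nonneg u]

variable {n : ℕ}

/-- The coordinates exceeding `s`. -/
noncomputable def layer (s : ℝ) (g : Fin n → ℝ) : Finset (Fin n) := univ.filter fun x => s < g x

lemma mem_layer {s : ℝ} {g : Fin n → ℝ} {x : Fin n} : x ∈ layer s g ↔ s < g x := by simp [layer]

/-- The indicator function of `layer s g = S`. -/
noncomputable def layInd (s : ℝ) (S : Finset (Fin n)) (g : Fin n → ℝ) : ℝ :=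
  if layer s g = S then 1 else 0

lemma layInd_nonneg (s : ℝ) (S : Finset (Fin n)) (g : Fin n → ℝ) : 0 ≤ layInd s S g := by
  unfold layInd; split_ifs <;> norm_num

lemma layInd_le_one (s : ℝ) (S : Finset (Fin n)) (g : Fin n → ℝ) : layInd s S g ≤ 1 := by
  unfold layInd; split_ifs <;> norm_num

lemma sum_layInd (s : ℝ) (g : Fin n → ℝ) : ∑ S, layInd s S g = 1 := by
  simp [layInd]

/-- One-dimensional factors of `layInd`. -/
noncomputable def layFactor (s : ℝ) (S : Finset (Fin n)) (y : Fin n) : ℝ → ℝ :=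
  (if y ∈ S then Set.Ioi s else Set.Iic s).indicator 1

lemma layInd_eq_prod (s : ℝ) (S : Finset (Fin n)) (g : Fin n → ℝ) :
    layInd s S g = ∏ y, layFactor s S y (g y) := by
  unfold layInd
  split_ifs with h
  · refine (prod_eq_one fun y _ => ?_).symm
    subst h
    unfold layFactor
    by_cases hy : s < g y
    · simp [mem_layer, hy]
    · simp [mem_layer, hy, not_lt.1 hy]
  · have : ∃ y, ¬ (y ∈ layer s g ↔ y ∈ S) := by
      by_contra! hcon; exact h (Finset.ext hcon)
    obtain ⟨y, hy⟩ := this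
    refine (prod_eq_zero (mem_univ y) ?_).symm
    rw [mem_layer] at hy
    unfold layFactor
    by_cases hS : y ∈ S
    · have : ¬ s < g y := by tauto
      simp [hS, not_lt.1 this]
    · have : s < g y := by tauto
      simp [hS, this]

lemma measurable_layFactor (s : ℝ) (S : Finset (Fin n)) (y : Fin n) :
    Measurable (layFactor s S y) := by
  unfold layFactor
  refine measurable_one.indicator ?_
  split_ifs
  · exact measurableSet_Ioi
  · exact measurableSet_Iic

lemma measurable_layInd (s : ℝ) (S : Finset (Fin n)) : Measurable (layInd s S) := by
  have : layInd s S = fun g => ∏ y, layFactor s S y (g y) := funext (layInd_eq_prod s S)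
  rw [this]
  exact Finset.measurable_prod _ fun y _ => (measurable_layFactor s S y).comp (measurable_pi_apply y)

lemma integrable_eval_gauss (x : Fin n) : Integrable (fun g : Fin n → ℝ => g x) (gauss n) :=
  integrable_comp_eval (μ := fun _ : Fin n => gaussianReal 0 1) (i := x) (f := fun u : ℝ => u)
    ((memLp_id_gaussianReal (μ := 0) (v := 1) 1).integrable (by simp))

lemma integrable_layInd_mul (s : ℝ) (S : Finset (Fin n)) {f : (Fin n → ℝ) → ℝ}
    (hf : Integrable f (gauss n)) : Integrable (fun g => layInd s S g * f g) (gauss n) :=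
  hf.bdd_mul (c := 1) (measurable_layInd s S).aestronglyMeasurable (ae_of_all _ fun g => by
    rw [Real.norm_of_nonneg (layInd_nonneg s S g)]; exact layInd_le_one s S g)

lemma integral_layFactor (s : ℝ) (S : Finset (Fin n)) (y : Fin n) :
    ∫ u, layFactor s S y u ∂gaussianReal 0 1 = if y ∈ S then tail s else 1 - tail s := by
  unfold layFactor
  split_ifs with h
  · rw [integral_indicator_one measurableSet_Ioi, tail]
  · rw [integral_indicator_one measurableSet_Iic, tail, ← Set.compl_Ioi,
      probReal_compl_eq_one_sub measurableSet_Ioi]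

lemma integral_layInd (s : ℝ) (S : Finset (Fin n)) :
    ∫ g, layInd s S g ∂gauss n = wt (tail s) S := by
  simp only [layInd_eq_prod]
  rw [integral_fintype_prod_eq_prod (fun y => layFactor s S y)]
  simp only [integral_layFactor, wt]

lemma integral_layInd_mul_eval (s : ℝ) (S : Finset (Fin n)) (x : Fin n) :
    ∫ g, layInd s S g * g x ∂gauss n = (∫ u, layFactor s S x u * u ∂gaussianReal 0 1) *
      ∏ y ∈ univ.erase x, if y ∈ S then tail s else 1 - tail s := by
  have e : ∀ g : Fin n → ℝ, layInd s S g * g x =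
      ∏ y, layFactor s S y (g y) * (if y = x then g y else 1) := by
    intro g
    rw [layInd_eq_prod, prod_mul_distrib]
    simp
  simp only [e]
  rw [integral_fintype_prod_eq_prod
    (fun y u => layFactor s S y u * (if y = x then u else 1)), ← mul_prod_erase univ _ (mem_univ x)]
  simp only [if_true]
  congr 1
  refine prod_congr rfl fun y hy => ?_
  simp only [(mem_erase.1 hy).1, if_false, mul_one, integral_layFactor]

lemma integral_layInd_mul_eval_mem (s : ℝ) {S : Finset (Fin n)} {x : Fin n} (hx : x ∈ S) :
    s * wt (tail s) S ≤ ∫ g, layInd s S g * g x ∂gauss n := by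
  rw [← integral_layInd, ← integral_const_mul]
  refine integral_mono ?_ (integrable_layInd_mul s S (integrable_eval_gauss x)) fun g => ?_
  · simpa using (integrable_layInd_mul s S (integrable_const (1 : ℝ))).const_mul s
  · simp only [layInd]
    split_ifs with h
    · subst h; simpa using (mem_layer.1 hx).le
    · simp

lemma integral_layInd_mul_eval_notMem {s : ℝ} (hs : tail s ≤ 1 / 2) {S : Finset (Fin n)}
    {x : Fin n} (hx : x ∉ S) :
    -2 * wt (tail s) S ≤ ∫ g, layInd s S g * g x ∂gauss n := by
  rw [integral_layInd_mul_eval, wt, ← mul_prod_erase univ _ (mem_univ x), ← mul_assoc]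
  refine mul_le_mul_of_nonneg_right ?_ (prod_nonneg fun y _ => ?_)
  · rw [if_neg hx]
    have := integral_Iic_id_ge s
    simp only [layFactor, if_neg hx]
    linarith
  · split_ifs
    · exact tail_nonneg s
    · linarith

end GaussianFacts

section SoftMax

variable {ι : Type*} [Fintype ι]

/-- The log-sum-exp function with an extra zero exponent. -/
noncomputable def LSE (v : ι → ℝ) : ℝ := Real.log (1 + ∑ i, Real.exp (v i))

/-- The gradient of `LSE`. -/
noncomputable def softmax (v : ι → ℝ) (i : ι) : ℝ := Real.exp (v i) / (1 + ∑ j, Real.exp (v j))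

lemma one_le_one_add_sum_exp (v : ι → ℝ) : 1 ≤ 1 + ∑ i, Real.exp (v i) :=
  le_add_of_nonneg_right (sum_nonneg fun _ _ => (Real.exp_pos _).le)

lemma LSE_nonneg (v : ι → ℝ) : 0 ≤ LSE v := Real.log_nonneg (one_le_one_add_sum_exp v)

lemma le_LSE (v : ι → ℝ) (i : ι) : v i ≤ LSE v := by
  have h0 := one_le_one_add_sum_exp v
  rw [LSE, Real.le_log_iff_exp_le (by linarith)]
  have := single_le_sum (f := fun i => Real.exp (v i)) (fun _ _ => (Real.exp_pos _).le) (mem_univ i)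
  linarith

lemma softmax_pos (v : ι → ℝ) (i : ι) : 0 < softmax v i :=
  div_pos (Real.exp_pos _) (by linarith [one_le_one_add_sum_exp v])

lemma sum_softmax_le_one (v : ι → ℝ) : ∑ i, softmax v i ≤ 1 := by
  have := one_le_one_add_sum_exp v
  simp only [softmax]
  rw [← sum_div, div_le_one (by linarith)]
  linarith

lemma softmax_le_one (v : ι → ℝ) (i : ι) : softmax v i ≤ 1 :=
  (single_le_sum (fun i _ => (softmax_pos v i).le) (mem_univ i)).trans (sum_softmax_le_one v)

lemma LSE_tangent (v w : ι → ℝ) : LSE v + ∑ i, softmax v i * (w i - v i) ≤ LSE w := by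
  have hv := one_le_one_add_sum_exp v
  have hw := one_le_one_add_sum_exp w
  set D := 1 + ∑ i, Real.exp (v i) with hD
  set S := ∑ i, softmax v i * (w i - v i) with hS
  have hDS : D * S = ∑ i, Real.exp (v i) * (w i - v i) := by
    rw [hS, mul_sum]
    refine sum_congr rfl fun i _ => ?_
    rw [softmax, ← hD]
    field_simp
  have h1 : Real.exp S * D ≤ 1 + ∑ i, Real.exp (w i) := by
    have a0 : Real.exp S * (1 - S) ≤ 1 := by
      have := Real.add_one_le_exp (-S)
      have h2 := mul_le_mul_of_nonneg_left this (Real.exp_pos S).le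
      rw [← Real.exp_add, add_neg_cancel, Real.exp_zero] at h2
      linarith
    have a1 : ∀ i, Real.exp S * (Real.exp (v i) * (1 + (w i - v i) - S)) ≤ Real.exp (w i) := by
      intro i
      have := Real.add_one_le_exp (w i - v i - S)
      have h2 := mul_le_mul_of_nonneg_left this (mul_pos (Real.exp_pos S) (Real.exp_pos (v i))).le
      rw [← Real.exp_add, ← Real.exp_add] at h2
      have e : S + v i + (w i - v i - S) = w i := by ring
      rw [e, Real.exp_add] at h2
      linarith
    have a2 := add_le_add a0 (sum_le_sum fun i (_ : i ∈ univ) => a1 i)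
    refine le_trans (le_of_eq ?_) a2
    rw [← mul_sum, ← mul_add]
    congr 1
    have : ∑ i, Real.exp (v i) * (1 + (w i - v i) - S) =
        (1 - S) * ∑ i, Real.exp (v i) + ∑ i, Real.exp (v i) * (w i - v i) := by
      rw [mul_sum, ← sum_add_distrib]
      exact sum_congr rfl fun i _ => by ring
    rw [this, ← hDS]
    have : ∑ i, Real.exp (v i) = D - 1 := by rw [hD]; ring
    rw [this]; ring
  rw [LSE, LSE, ← hD, Real.le_log_iff_exp_le (by linarith), Real.exp_add, Real.exp_log (by linarith)]
  linarith

lemma LSE_sub_le (v w : ι → ℝ) : LSE v - LSE w ≤ ∑ i, |v i - w i| := by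
  have h := LSE_tangent v w
  have : ∑ i, softmax v i * (v i - w i) ≤ ∑ i, |v i - w i| := sum_le_sum fun i _ => by
    have h1 := softmax_le_one v i
    have h2 := softmax_pos v i
    have := le_abs_self (v i - w i)
    have := abs_nonneg (v i - w i)
    nlinarith
  have e : ∑ i, softmax v i * (w i - v i) = -∑ i, softmax v i * (v i - w i) := by
    rw [← sum_neg_distrib]; exact sum_congr rfl fun i _ => by ring
  linarith

lemma LSE_zero : LSE (0 : ι → ℝ) = Real.log (1 + Fintype.card ι) := by
  simp [LSE]

lemma LSE_midpoint (v w : ι → ℝ) : 2 * LSE (fun i => (v i + w i) / 2) ≤ LSE v + LSE w := by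
  have h1 := LSE_tangent (fun i => (v i + w i) / 2) v
  have h2 := LSE_tangent (fun i => (v i + w i) / 2) w
  have e : ∑ i, softmax (fun i => (v i + w i) / 2) i * (v i - (v i + w i) / 2) =
      -∑ i, softmax (fun i => (v i + w i) / 2) i * (w i - (v i + w i) / 2) := by
    rw [← sum_neg_distrib]; exact sum_congr rfl fun i _ => by ring
  linarith

lemma softmax_midpoint (v w : ι → ℝ) (i : ι) :
    softmax v i * softmax w i ≤ softmax (fun i => (v i + w i) / 2) i ^ 2 := by
  have key : ∀ u : ι → ℝ, softmax u i = Real.exp (u i - LSE u) := by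
    intro u
    rw [Real.exp_sub, LSE, Real.exp_log (by linarith [one_le_one_add_sum_exp u]), softmax]
  rw [key, key, key, ← Real.exp_add, ← Real.exp_nat_mul]
  refine Real.exp_le_exp.2 ?_
  have := LSE_midpoint v w
  push_cast
  linarith

lemma continuous_LSE : Continuous (LSE : (ι → ℝ) → ℝ) := by
  unfold LSE
  exact Continuous.log (by fun_prop) fun v => by linarith [one_le_one_add_sum_exp v]

lemma continuous_softmax (i : ι) : Continuous fun v : ι → ℝ => softmax v i := by
  unfold softmax
  exact Continuous.div (by fun_prop) (by fun_prop) fun v => by linarith [one_le_one_add_sum_exp v]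

end SoftMax

section Saddle

open MeasureTheory ProbabilityTheory

variable {ι : Type*} {n : ℕ} (R : ι → Finset (Fin n)) (t : ℝ)

/-- The exponents: affine functions of `g` supported on the sets `R i`. -/
noncomputable def expo (e : (ι → Fin n → ℝ) × (ι → ℝ)) (g : Fin n → ℝ) (i : ι) : ℝ :=
  ∑ x ∈ R i, e.1 i x * (g x - t) + e.2 i

lemma expo_add_smul (e f : (ι → Fin n → ℝ) × (ι → ℝ)) (r : ℝ) (g : Fin n → ℝ) (i : ι) :
    expo R t (e + r • f) g i = expo R t e g i + r * expo R t f g i := by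
  simp only [expo, Prod.fst_add, Prod.snd_add, Prod.smul_fst, Prod.smul_snd, Pi.add_apply,
    Pi.smul_apply, smul_eq_mul, mul_add, mul_sum]
  rw [add_add_add_comm, ← sum_add_distrib]
  congr 1
  exact sum_congr rfl fun x _ => by ring

lemma continuous_expo (e : (ι → Fin n → ℝ) × (ι → ℝ)) : Continuous (expo R t e) := by
  unfold expo; fun_prop

lemma expo_midpoint (e : (ι → Fin n → ℝ) × (ι → ℝ)) (g g' : Fin n → ℝ) :
    expo R t e (fun x => (g x + g' x) / 2) = fun i => (expo R t e g i + expo R t e g' i) / 2 := by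
  ext i
  simp only [expo]
  rw [add_add_add_comm, ← sum_add_distrib, add_div, sum_div]
  congr 1
  · exact sum_congr rfl fun x _ => by ring
  · ring

lemma integrable_expo (e : (ι → Fin n → ℝ) × (ι → ℝ)) (i : ι) :
    Integrable (fun g => expo R t e g i) (gauss n) := by
  unfold expo
  refine Integrable.add (integrable_finsetSum _ fun x _ => ?_) (integrable_const _)
  exact ((integrable_eval_gauss x).sub (integrable_const t)).const_mul _

variable [Fintype ι]

lemma integrable_LSE (e : (ι → Fin n → ℝ) × (ι → ℝ)) :
    Integrable (fun g => LSE (expo R t e g)) (gauss n) := by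
  refine Integrable.mono' (g := fun g => LSE (0 : ι → ℝ) + ∑ i, |expo R t e g i|) ?_
    (continuous_LSE.comp (continuous_expo R t e)).aestronglyMeasurable (ae_of_all _ fun g => ?_)
  · exact (integrable_const _).add (integrable_finsetSum _ fun i _ => (integrable_expo R t e i).abs)
  · rw [Real.norm_of_nonneg (LSE_nonneg _)]
    have := LSE_sub_le (expo R t e g) 0
    simp only [Pi.zero_apply, sub_zero] at this
    linarith

lemma integrable_softmax_mul (e : (ι → Fin n → ℝ) × (ι → ℝ)) (i : ι) {f : (Fin n → ℝ) → ℝ}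
    (hf : Integrable f (gauss n)) :
    Integrable (fun g => softmax (expo R t e g) i * f g) (gauss n) :=
  hf.bdd_mul (c := 1)
    ((continuous_softmax i).comp (continuous_expo R t e)).aestronglyMeasurable
    (ae_of_all _ fun g => by
      rw [Real.norm_of_nonneg (softmax_pos _ i).le]; exact softmax_le_one _ i)

lemma integrable_softmax (e : (ι → Fin n → ℝ) × (ι → ℝ)) (i : ι) :
    Integrable (fun g => softmax (expo R t e g) i) (gauss n) := by
  simpa using integrable_softmax_mul R t e i (integrable_const (1 : ℝ))

/-- The convex potential. -/
noncomputable def potential (ν : ι → ℝ) (e : (ι → Fin n → ℝ) × (ι → ℝ)) : ℝ :=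
  ∫ g, LSE (expo R t e g) ∂gauss n - ∑ i, ν i * e.2 i

lemma potential_first_order {ν : ι → ℝ} {θ e : (ι → Fin n → ℝ) × (ι → ℝ)}
    (hmin : ∀ r : ℝ, 0 < r → r ≤ 1 → potential R t ν θ ≤ potential R t ν (θ + r • e)) :
    ∑ i, ν i * e.2 i ≤ ∑ i, ∫ g, softmax (expo R t θ g) i * expo R t e g i ∂gauss n := by
  have step : ∀ r : ℝ, 0 < r → r ≤ 1 → ∑ i, ν i * e.2 i ≤
      ∑ i, ∫ g, softmax (expo R t (θ + r • e) g) i * expo R t e g i ∂gauss n := by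
    intro r hr hr1
    have h1 := hmin r hr hr1
    have h2 : ∫ g, (LSE (expo R t (θ + r • e) g) +
        ∑ i, softmax (expo R t (θ + r • e) g) i * (-r * expo R t e g i)) ∂gauss n ≤
        ∫ g, LSE (expo R t θ g) ∂gauss n := by
      refine integral_mono ((integrable_LSE R t _).add (integrable_finsetSum _ fun i _ =>
        integrable_softmax_mul R t _ i ((integrable_expo R t e i).const_mul _)))
        (integrable_LSE R t θ) fun g => ?_
      have := LSE_tangent (expo R t (θ + r • e) g) (expo R t θ g)
      refine le_trans (le_of_eq ?_) this
      simp only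
      congr 1
      refine sum_congr rfl fun i _ => ?_
      rw [expo_add_smul]; ring
    rw [integral_add (integrable_LSE R t _) (integrable_finsetSum _ fun i _ =>
        integrable_softmax_mul R t _ i ((integrable_expo R t e i).const_mul _)),
      integral_finsetSum _ fun i _ =>
        integrable_softmax_mul R t _ i ((integrable_expo R t e i).const_mul _)] at h2
    have h3 : ∀ i, ∫ g, softmax (expo R t (θ + r • e) g) i * (-r * expo R t e g i) ∂gauss n =
        -r * ∫ g, softmax (expo R t (θ + r • e) g) i * expo R t e g i ∂gauss n := by
      intro i
      rw [← integral_const_mul]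
      exact integral_congr_ae (ae_of_all _ fun g => by ring)
    simp only [h3, ← mul_sum] at h2
    simp only [potential, Prod.snd_add, Prod.smul_snd, Pi.add_apply, Pi.smul_apply, smul_eq_mul,
      mul_add, sum_add_distrib] at h1
    have h4 : ∑ i, ν i * (r * e.2 i) = r * ∑ i, ν i * e.2 i := by
      rw [mul_sum]; exact sum_congr rfl fun i _ => by ring
    rw [h4] at h1
    refine le_of_mul_le_mul_left ?_ hr
    linarith
  have hlim : Filter.Tendsto (fun k : ℕ => ∑ i, ∫ g, softmax (expo R t
      (θ + (1 / ((k : ℝ) + 1)) • e) g) i * expo R t e g i ∂gauss n) Filter.atTop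
      (nhds (∑ i, ∫ g, softmax (expo R t θ g) i * expo R t e g i ∂gauss n)) := by
    refine tendsto_finsetSum _ fun i _ => ?_
    refine tendsto_integral_of_dominated_convergence (fun g => |expo R t e g i|)
      (fun k => (integrable_softmax_mul R t _ i (integrable_expo R t e i)).aestronglyMeasurable)
      (integrable_expo R t e i).abs (fun k => ae_of_all _ fun g => ?_) (ae_of_all _ fun g => ?_)
    · rw [Real.norm_eq_abs, abs_mul, abs_of_pos (softmax_pos _ i)]
      exact mul_le_of_le_one_left (abs_nonneg _) (softmax_le_one _ i)
    · refine Filter.Tendsto.mul_const _ ?_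
      refine ((continuous_softmax i).tendsto _).comp ?_
      rw [tendsto_pi_nhds]
      intro j
      simp only [expo_add_smul]
      have h0 := tendsto_one_div_add_atTop_nhds_zero_nat (𝕜 := ℝ)
      simpa using (h0.mul_const (expo R t e g j)).const_add (expo R t θ g j)
  refine ge_of_tendsto' hlim fun k => step _ (by positivity) ?_
  rw [div_le_one (by positivity)]
  have : (0:ℝ) ≤ k := Nat.cast_nonneg k
  linarith

end Saddle

section Minimizer

open MeasureTheory ProbabilityTheory

variable {ι : Type*} [Fintype ι] {n : ℕ} (R : ι → Finset (Fin n)) (t : ℝ)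

/-- The convex domain of the potential. -/
def domain (R : ι → Finset (Fin n)) (B : ℝ) : Set ((ι → Fin n → ℝ) × (ι → ℝ)) :=
  {θ | (∀ i x, 0 ≤ θ.1 i x) ∧ (∀ i x, x ∉ R i → θ.1 i x = 0) ∧ ∀ i, θ.2 i ≤ B}

lemma wt_univ_pos {V : Type*} [Fintype V] [DecidableEq V] {a : ℝ} (ha : 0 < a) :
    0 < wt a (univ : Finset V) := by
  unfold wt
  exact prod_pos fun x _ => by simpa using ha

lemma tail_pos {s : ℝ} (hs : 0 ≤ s) : 0 < tail s := (Real.exp_pos _).trans_le (le_tail hs)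

lemma mul_le_integral_LSE {B : ℝ} {θ : (ι → Fin n → ℝ) × (ι → ℝ)} (hθ : θ ∈ domain R B) (i : ι) :
    wt (tail (t + 1)) (univ : Finset (Fin n)) * (∑ x ∈ R i, θ.1 i x + θ.2 i) ≤
      ∫ g, LSE (expo R t θ g) ∂gauss n := by
  rw [← integral_layInd, ← integral_mul_const]
  refine integral_mono (integrable_layInd_mul _ _ (integrable_const _)) (integrable_LSE R t θ)
    fun g => ?_
  simp only [layInd]
  split_ifs with h
  · rw [one_mul]
    refine le_trans ?_ (le_LSE _ i)
    unfold expo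
    refine add_le_add_left (sum_le_sum fun x _ => ?_) _
    have hx : x ∈ layer (t + 1) g := h ▸ mem_univ x
    rw [mem_layer] at hx
    nlinarith [hθ.1 i x]
  · rw [zero_mul]
    exact LSE_nonneg _

lemma continuousOn_potential (ν : ι → ℝ) (M : ℝ) :
    ContinuousOn (potential R t ν) {θ | (∀ i x, |θ.1 i x| ≤ M) ∧ ∀ i, |θ.2 i| ≤ M} := by
  unfold potential
  refine ContinuousOn.sub ?_ (by fun_prop)
  refine continuousOn_of_dominated
    (bound := fun g => LSE (0 : ι → ℝ) + ∑ i, (∑ x ∈ R i, M * |g x - t| + M))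
    (fun θ _ => (integrable_LSE R t θ).aestronglyMeasurable) (fun θ hθ => ae_of_all _ fun g => ?_)
    ?_ (ae_of_all _ fun g => ?_)
  · rw [Real.norm_of_nonneg (LSE_nonneg _)]
    have h1 := LSE_sub_le (expo R t θ g) 0
    simp only [Pi.zero_apply, sub_zero] at h1
    have h2 : ∑ i, |expo R t θ g i| ≤ ∑ i, (∑ x ∈ R i, M * |g x - t| + M) := by
      refine sum_le_sum fun i _ => (abs_add_le _ _).trans (add_le_add ?_ (hθ.2 i))
      refine (abs_sum_le_sum_abs _ _).trans (sum_le_sum fun x _ => ?_)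
      rw [abs_mul]
      exact mul_le_mul_of_nonneg_right (hθ.1 i x) (abs_nonneg _)
    linarith
  · refine (integrable_const _).add (integrable_finsetSum _ fun i _ => Integrable.add
      (integrable_finsetSum _ fun x _ => ?_) (integrable_const _))
    exact ((integrable_eval_gauss x).sub (integrable_const t)).abs.const_mul _
  · refine (continuous_LSE.comp ?_).continuousOn
    unfold expo
    fun_prop

lemma exists_minimizer (ht : 0 ≤ t) {ν : ι → ℝ} (hν : ∀ i, 0 < ν i) {B : ℝ} (hB : 0 ≤ B) :
    ∃ θ ∈ domain R B, ∀ θ' ∈ domain R B, potential R t ν θ ≤ potential R t ν θ' := by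
  have hc : 0 < wt (tail (t + 1)) (univ : Finset (Fin n)) := wt_univ_pos (tail_pos (by linarith))
  set c := wt (tail (t + 1)) (univ : Finset (Fin n)) with hcdef
  set C := potential R t ν 0 + B * ∑ i, ν i with hC
  have hint0 : ∀ θ, 0 ≤ ∫ g, LSE (expo R t θ g) ∂gauss n := fun θ =>
    integral_nonneg fun g => LSE_nonneg _
  have hC0 : 0 ≤ C := by
    have h1 := hint0 0
    have h2 : 0 ≤ B * ∑ i, ν i := mul_nonneg hB (sum_nonneg fun i _ => (hν i).le)
    have h3 : potential R t ν 0 = ∫ g, LSE (expo R t 0 g) ∂gauss n := by simp [potential]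
    linarith
  set M := C / c + ∑ i, C / ν i + B with hM
  have hdiv : ∀ i, 0 ≤ C / ν i := fun i => div_nonneg hC0 (hν i).le
  have hdiv' : ∀ i, C / ν i ≤ ∑ i, C / ν i := fun i =>
    single_le_sum (f := fun i => C / ν i) (fun i _ => hdiv i) (mem_univ i)
  have hcc : 0 ≤ C / c := div_nonneg hC0 hc.le
  have hsum0 : 0 ≤ ∑ i, C / ν i := sum_nonneg fun i _ => hdiv i
  have hM0 : 0 ≤ M := by linarith
  set K' : Set ((ι → Fin n → ℝ) × (ι → ℝ)) :=
    Set.Icc (0, fun _ => -M) (fun _ _ => M, fun _ => B) ∩ {θ | ∀ i x, x ∉ R i → θ.1 i x = 0} with hK'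
  have hcomp : IsCompact K' := by
    refine isCompact_Icc.inter_right ?_
    simp only [Set.ofPred_forall]
    refine isClosed_iInter fun i => isClosed_iInter fun x => isClosed_iInter fun _ => ?_
    exact isClosed_eq (by fun_prop) continuous_const
  have h0 : (0 : (ι → Fin n → ℝ) × (ι → ℝ)) ∈ K' := by
    refine ⟨⟨⟨le_rfl, fun i => ?_⟩, ⟨fun i x => hM0, fun i => hB⟩⟩, fun i x _ => rfl⟩
    simpa using hM0
  have hcont : ContinuousOn (potential R t ν) K' := by
    refine (continuousOn_potential R t ν M).mono fun θ hθ => ⟨fun i x => ?_, fun i => ?_⟩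
    · have h1 := hθ.1.1.1 i x
      have h2 := hθ.1.2.1 i x
      simp only [Pi.zero_apply] at h1 h2
      exact abs_le.2 ⟨by linarith, h2⟩
    · have h1 := hθ.1.1.2 i
      have h2 := hθ.1.2.2 i
      simp only at h1 h2
      exact abs_le.2 ⟨h1, by linarith⟩
  obtain ⟨θ, hθ, hmin⟩ := hcomp.exists_isMinOn ⟨0, h0⟩ hcont
  refine ⟨θ, ⟨fun i x => hθ.1.1.1 i x, hθ.2, fun i => hθ.1.2.2 i⟩, fun θ' hθ' => ?_⟩
  rcases le_total (potential R t ν θ') (potential R t ν 0) with h | h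
  · refine hmin ⟨⟨⟨fun i x => hθ'.1 i x, fun i => ?_⟩, ⟨fun i x => ?_, fun i => hθ'.2.2 i⟩⟩, hθ'.2.1⟩
    all_goals
      have hE := hint0 θ'
      have hE' : ∫ g, LSE (expo R t θ' g) ∂gauss n ≤ potential R t ν 0 + ∑ i, ν i * θ'.2 i := by
        simp only [potential] at h ⊢; linarith
      have hall : ∑ j, ν j * θ'.2 j ≤ B * ∑ i, ν i := by
        rw [mul_sum]
        exact sum_le_sum fun j _ => by nlinarith [hν j, hθ'.2.2 j]
      have hone : ∑ j, ν j * θ'.2 j ≤ ν i * θ'.2 i + B * ∑ i, ν i := by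
        classical
        rw [← add_sum_erase _ _ (mem_univ i)]
        have : ∑ j ∈ univ.erase i, ν j * θ'.2 j ≤ ∑ j ∈ univ.erase i, B * ν j :=
          sum_le_sum fun j _ => by nlinarith [hν j, hθ'.2.2 j]
        have h2 : ∑ j ∈ univ.erase i, B * ν j ≤ ∑ j, B * ν j :=
          sum_le_sum_of_subset_of_nonneg (erase_subset _ _) fun j _ _ => mul_nonneg hB (hν j).le
        rw [mul_sum]
        linarith
      have hb : -(C / ν i) ≤ θ'.2 i := by
        rw [← neg_div, div_le_iff₀ (hν i)]
        linarith
    · change -M ≤ θ'.2 i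
      linarith [hdiv' i]
    · change θ'.1 i x ≤ M
      by_cases hx : x ∈ R i
      · have h1 := mul_le_integral_LSE R t hθ' i
        have h2 : ∑ x ∈ R i, θ'.1 i x + θ'.2 i ≤ C / c := by
          rw [le_div_iff₀ hc]; linarith
        have h3 : θ'.1 i x ≤ ∑ x ∈ R i, θ'.1 i x :=
          single_le_sum (f := fun x => θ'.1 i x) (fun x _ => hθ'.1 i x) hx
        linarith [hdiv' i]
      · rw [hθ'.2.1 i x hx]; exact hM0
  · exact (hmin h0).trans h

end Minimizer

section KKT

open MeasureTheory ProbabilityTheory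

variable {ι : Type*} [Fintype ι] {n : ℕ}

/-- The integral of the `i`-th component of the soft-max. -/
noncomputable def mass (m : ι → (Fin n → ℝ) → ℝ) (i : ι) : ℝ := ∫ g, m i g ∂gauss n

lemma integral_layInd_mul_LSE_ge (R : ι → Finset (Fin n)) {t : ℝ} (ht : 0 ≤ t)
    (hs : tail (2 * t + 2) ≤ 1 / 2) (θ : (ι → Fin n → ℝ) × (ι → ℝ)) (hθ : ∀ i x, 0 ≤ θ.1 i x)
    {i : ι} {S : Finset (Fin n)} (hg : Good (θ.1 i) (R i) S) :
    wt (tail (2 * t + 2)) S * θ.2 i ≤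
      ∫ g, layInd (2 * t + 2) S g * LSE (expo R t θ g) ∂gauss n := by
  have h1 : ∫ g, layInd (2 * t + 2) S g * expo R t θ g i ∂gauss n ≤
      ∫ g, layInd (2 * t + 2) S g * LSE (expo R t θ g) ∂gauss n :=
    integral_mono (integrable_layInd_mul _ _ (integrable_expo R t θ i))
      (integrable_layInd_mul _ _ (integrable_LSE R t θ))
      fun g => mul_le_mul_of_nonneg_left (le_LSE _ i) (layInd_nonneg _ _ _)
  refine le_trans ?_ h1
  have hI : ∀ x, Integrable (fun g => layInd (2 * t + 2) S g * g x) (gauss n) := fun x =>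
    integrable_layInd_mul _ _ (integrable_eval_gauss x)
  have hI0 : Integrable (layInd (2 * t + 2) S) (gauss n) := by
    simpa using integrable_layInd_mul (2 * t + 2) S (integrable_const (1:ℝ) (μ := gauss n))
  have e : ∫ g, layInd (2 * t + 2) S g * expo R t θ g i ∂gauss n =
      ∑ x ∈ R i, θ.1 i x * ((∫ g, layInd (2 * t + 2) S g * g x ∂gauss n) -
        t * wt (tail (2 * t + 2)) S) + θ.2 i * wt (tail (2 * t + 2)) S := by
    have e1 : ∀ g, layInd (2 * t + 2) S g * expo R t θ g i =
        ∑ x ∈ R i, θ.1 i x * (layInd (2 * t + 2) S g * g x - t * layInd (2 * t + 2) S g) +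
          θ.2 i * layInd (2 * t + 2) S g := by
      intro g
      simp only [expo, mul_add, mul_sum]
      congr 1
      · exact sum_congr rfl fun x _ => by ring
      · ring
    simp only [e1]
    have hI2 : ∀ x, Integrable (fun g => θ.1 i x * (layInd (2 * t + 2) S g * g x -
        t * layInd (2 * t + 2) S g)) (gauss n) := fun x => ((hI x).sub (hI0.const_mul _)).const_mul _
    rw [integral_add (integrable_finsetSum _ fun x _ => hI2 x) (hI0.const_mul _),
      integral_finsetSum _ fun x _ => hI2 x, integral_const_mul, integral_layInd]
    congr 1
    refine sum_congr rfl fun x _ => ?_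
    rw [integral_const_mul, integral_sub (hI x) (hI0.const_mul _), integral_const_mul,
      integral_layInd]
  rw [e]
  have hw : 0 ≤ wt (tail (2 * t + 2)) S := wt_nonneg (tail_nonneg _) (tail_le_one _) S
  set w := wt (tail (2 * t + 2)) S
  have key : ∑ x ∈ R i, θ.1 i x * (if x ∈ S then (t + 2) * w else -((t + 2) * w)) ≤
      ∑ x ∈ R i, θ.1 i x * ((∫ g, layInd (2 * t + 2) S g * g x ∂gauss n) - t * w) := by
    refine sum_le_sum fun x _ => mul_le_mul_of_nonneg_left ?_ (hθ i x)
    split_ifs with hx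
    · have := integral_layInd_mul_eval_mem (2 * t + 2) hx
      linarith
    · have := integral_layInd_mul_eval_notMem hs hx
      linarith
  have key2 : ∑ x ∈ R i, θ.1 i x * (if x ∈ S then (t + 2) * w else -((t + 2) * w)) =
      (t + 2) * w * (2 * ∑ x ∈ R i ∩ S, θ.1 i x - ∑ x ∈ R i, θ.1 i x) := by
    rw [← filter_mem_eq_inter, sum_filter, mul_sum, ← sum_sub_distrib, mul_sum]
    refine sum_congr rfl fun x _ => ?_
    split_ifs <;> ring
  have : 0 ≤ (t + 2) * w * (2 * ∑ x ∈ R i ∩ S, θ.1 i x - ∑ x ∈ R i, θ.1 i x) :=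
    mul_nonneg (mul_nonneg (by linarith) hw) (by unfold Good at hg; linarith)
  linarith

/-- Dual certificates: log-concave densities `m i` whose barycentre dominates `t` on `R i`. -/
theorem exists_dual (R : ι → Finset (Fin n)) {t : ℝ} (ht : 0 ≤ t)
    (hs : tail (2 * t + 2) ≤ 1 / 2) {ν : ι → ℝ} (hν : ∀ i, 0 < ν i) {B : ℝ} (hB : 0 ≤ B) :
    ∃ (h : ι → Fin n → ℝ) (b : ι → ℝ) (m : ι → (Fin n → ℝ) → ℝ),
      (∀ i x, 0 ≤ h i x) ∧ (∀ i, b i ≤ B) ∧ (∀ i, Continuous (m i)) ∧ (∀ i g, 0 < m i g) ∧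
      (∀ g, ∑ i, m i g ≤ 1) ∧
      (∀ i g g', m i g * m i g' ≤ m i (fun x => (g x + g' x) / 2) ^ 2) ∧
      (∀ i, mass m i ≤ ν i) ∧ (∀ i, b i < B → mass m i = ν i) ∧
      (∀ i, ∀ x ∈ R i, t * mass m i ≤ ∫ g, m i g * g x ∂gauss n) ∧
      ∀ y : Finset (Fin n) → ℝ,
        (∀ S, y S ≤ 0 ∨ ∃ i, Good (h i) (R i) S ∧ y S ≤ b i) →
        ∑ S, wt (tail (2 * t + 2)) S * y S ≤
          ∑ i, b i * mass m i + Real.log (1 + Fintype.card ι) := by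
  classical
  obtain ⟨θ, hθ, hmin⟩ := exists_minimizer R t ht hν hB
  set m : ι → (Fin n → ℝ) → ℝ := fun i g => softmax (expo R t θ g) i with hm
  have first : ∀ e : (ι → Fin n → ℝ) × (ι → ℝ),
      (∀ r : ℝ, 0 < r → r ≤ 1 → θ + r • e ∈ domain R B) →
      ∑ i, ν i * e.2 i ≤ ∑ i, ∫ g, m i g * expo R t e g i ∂gauss n :=
    fun e he => potential_first_order R t fun r h0 h1 => hmin _ (he r h0 h1)
  have hmI : ∀ i, Integrable (m i) (gauss n) := fun i => integrable_softmax R t θ i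
  have hmx : ∀ i x, Integrable (fun g => m i g * g x) (gauss n) := fun i x =>
    integrable_softmax_mul R t θ i (integrable_eval_gauss x)
  have hconst : ∀ (β : ι → ℝ), ∑ i, ∫ g, m i g * expo R t (0, β) g i ∂gauss n =
      ∑ i, β i * mass m i := by
    intro β
    refine sum_congr rfl fun i _ => ?_
    simp only [expo, Pi.zero_apply, zero_mul, sum_const_zero, zero_add, mass]
    rw [integral_mul_const, mul_comm]
  have hle : ∀ i, mass m i ≤ ν i := by
    intro i
    have := first (0, -Pi.single i 1) fun r h0 h1 => ⟨fun j x => ?_, fun j x hx => ?_, fun j => ?_⟩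
    · rw [hconst] at this
      simp [Pi.single_apply] at this
      exact this
    · simpa using hθ.1 j x
    · simpa using hθ.2.1 j x hx
    · have h2 := hθ.2.2 j
      have : 0 ≤ (Pi.single i 1 : ι → ℝ) j := by
        rw [Pi.single_apply]; split_ifs <;> norm_num
      simp only [Prod.snd_add, Prod.smul_snd, Pi.add_apply, Pi.smul_apply, Pi.neg_apply, smul_eq_mul]
      nlinarith
  refine ⟨θ.1, θ.2, m, hθ.1, hθ.2.2,
    fun i => (continuous_softmax i).comp (continuous_expo R t θ), fun i g => softmax_pos _ i,
    fun g => sum_softmax_le_one _, fun i g g' => ?_, hle, fun i hi => ?_, fun i x hx => ?_,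
    fun y hy => ?_⟩
  · have := softmax_midpoint (expo R t θ g) (expo R t θ g') i
    simp only [hm, expo_midpoint]
    exact this
  · refine le_antisymm (hle i) ?_
    have := first (0, Pi.single i (B - θ.2 i)) fun r h0 h1 =>
      ⟨fun j x => ?_, fun j x hx => ?_, fun j => ?_⟩
    · rw [hconst] at this
      simp [Pi.single_apply] at this
      have hp : 0 < B - θ.2 i := by linarith
      rw [mul_comm] at this
      exact le_of_mul_le_mul_left this hp
    · simpa using hθ.1 j x
    · simpa using hθ.2.1 j x hx
    · simp only [Prod.snd_add, Prod.smul_snd, Pi.add_apply, Pi.smul_apply, smul_eq_mul,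
        Pi.single_apply]
      split_ifs with hj
      · subst hj; nlinarith
      · simpa using hθ.2.2 j
  · have := first (Pi.single i (Pi.single x 1), 0) fun r h0 h1 =>
      ⟨fun j z => ?_, fun j z hz => ?_, fun j => ?_⟩
    · have e : ∑ j, ∫ g, m j g * expo R t (Pi.single i (Pi.single x 1), 0) g j ∂gauss n =
          ∫ g, m i g * (g x - t) ∂gauss n := by
        rw [sum_eq_single i]
        · refine integral_congr_ae (ae_of_all _ fun g => ?_)
          simp [expo, Pi.single_apply, hx]
        · intro j _ hj
          simp [expo, Pi.single_eq_of_ne hj]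
        · simp
      rw [e] at this
      simp only [Pi.zero_apply, mul_zero, sum_const_zero, mul_sub] at this
      rw [integral_sub (hmx i x) ((hmI i).mul_const t), integral_mul_const] at this
      simp only [mass]
      linarith
    · have h2 := hθ.1 j z
      have : 0 ≤ (Pi.single i (Pi.single x 1) : ι → Fin n → ℝ) j z := by
        by_cases hj : j = i
        · subst hj
          rw [Pi.single_eq_same, Pi.single_apply]
          split_ifs <;> norm_num
        · rw [Pi.single_eq_of_ne hj]; rfl
      simp only [Prod.fst_add, Prod.smul_fst, Pi.add_apply, Pi.smul_apply, smul_eq_mul]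
      nlinarith
    · have h2 := hθ.2.1 j z hz
      have : (Pi.single i (Pi.single x 1) : ι → Fin n → ℝ) j z = 0 := by
        by_cases hj : j = i
        · subst hj
          rw [Pi.single_eq_same, Pi.single_eq_of_ne]
          rintro rfl
          exact hz hx
        · rw [Pi.single_eq_of_ne hj]; rfl
      simp only [Prod.fst_add, Prod.smul_fst, Pi.add_apply, Pi.smul_apply, smul_eq_mul, h2, this]
      ring
    · simpa using hθ.2.2 j
  · have hdual : ∑ i, ∫ g, m i g * expo R t θ g i ∂gauss n ≤ ∑ i, θ.2 i * mass m i := by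
      have := first (-θ.1, 0) fun r h0 h1 => ⟨fun j x => ?_, fun j x hx => ?_, fun j => ?_⟩
      · have e : ∀ i, ∫ g, m i g * expo R t (-θ.1, 0) g i ∂gauss n =
            -(∫ g, m i g * expo R t θ g i ∂gauss n) + θ.2 i * mass m i := by
          intro i
          have hI : Integrable (fun g => -(m i g * expo R t θ g i)) (gauss n) :=
            (integrable_softmax_mul R t θ i (integrable_expo R t θ i)).neg
          rw [← integral_neg, mass, ← integral_const_mul, ← integral_add hI ((hmI i).const_mul _)]
          refine integral_congr_ae (ae_of_all _ fun g => ?_)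
          simp only [expo, Pi.neg_apply, neg_mul, sum_neg_distrib, Pi.zero_apply, add_zero]
          ring
        simp only [e, Pi.zero_apply, mul_zero, sum_const_zero, sum_add_distrib,
          sum_neg_distrib] at this
        linarith
      · have h2 := hθ.1 j x
        simp only [Prod.fst_add, Prod.smul_fst, Pi.add_apply, Pi.smul_apply, smul_eq_mul,
          Pi.neg_apply]
        nlinarith
      · have h2 := hθ.2.1 j x hx
        simp [h2]
      · simpa using hθ.2.2 j
    have htan : ∫ g, LSE (expo R t θ g) ∂gauss n ≤
        ∑ i, ∫ g, m i g * expo R t θ g i ∂gauss n + Real.log (1 + Fintype.card ι) := by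
      have hI : ∀ i, Integrable (fun g => m i g * expo R t θ g i) (gauss n) := fun i =>
        integrable_softmax_mul R t θ i (integrable_expo R t θ i)
      rw [← integral_finsetSum _ fun i _ => hI i]
      have : Real.log (1 + Fintype.card ι) =
          ∫ _g : Fin n → ℝ, Real.log (1 + Fintype.card ι) ∂gauss n := by simp
      rw [this, ← integral_add (integrable_finsetSum _ fun i _ => hI i) (integrable_const _)]
      refine integral_mono (integrable_LSE R t θ)
        ((integrable_finsetSum _ fun i _ => hI i).add (integrable_const _)) fun g => ?_
      have h3 := LSE_tangent (expo R t θ g) 0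
      rw [LSE_zero] at h3
      simp only [Pi.zero_apply, zero_sub, mul_neg, sum_neg_distrib] at h3
      simp only [hm]
      linarith
    have hlow : ∑ S, wt (tail (2 * t + 2)) S * y S ≤ ∫ g, LSE (expo R t θ g) ∂gauss n := by
      have e : ∫ g, LSE (expo R t θ g) ∂gauss n =
          ∑ S, ∫ g, layInd (2 * t + 2) S g * LSE (expo R t θ g) ∂gauss n := by
        rw [← integral_finsetSum _ fun S _ => integrable_layInd_mul _ _ (integrable_LSE R t θ)]
        refine integral_congr_ae (ae_of_all _ fun g => ?_)
        simp only
        rw [← sum_mul, sum_layInd, one_mul]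
      rw [e]
      refine sum_le_sum fun S _ => ?_
      have hw : 0 ≤ wt (tail (2 * t + 2)) S := wt_nonneg (tail_nonneg _) (tail_le_one _) S
      rcases hy S with h | ⟨i, hg, hi⟩
      · exact (mul_nonpos_of_nonneg_of_nonpos hw h).trans
          (integral_nonneg fun g => mul_nonneg (layInd_nonneg _ _ _) (LSE_nonneg _))
      · exact (mul_le_mul_of_nonneg_left hi hw).trans
          (integral_layInd_mul_LSE_ge R ht hs θ hθ.1 hg)
    linarith

end KKT

section LaplaceTransform

open MeasureTheory ProbabilityTheory

variable {n : ℕ}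

lemma integrable_exp_mul_sum (I : Finset (Fin n)) (r : ℝ) :
    Integrable (fun g : Fin n → ℝ => Real.exp (r * ∑ x ∈ I, g x)) (gauss n) := by
  have e : (fun g : Fin n → ℝ => Real.exp (r * ∑ x ∈ I, g x)) =
      fun g => ∏ x, Real.exp ((if x ∈ I then r else 0) * g x) := by
    ext g
    rw [← Real.exp_sum, mul_sum, ← sum_filter_add_sum_filter_not univ (· ∈ I)]
    congr 1
    rw [filter_mem_eq_inter, univ_inter]
    have : ∑ x with x ∉ I, (if x ∈ I then r else 0) * g x = 0 :=
      sum_eq_zero fun x hx => by rw [if_neg (mem_filter.1 hx).2, zero_mul]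
    rw [this, add_zero]
    exact sum_congr rfl fun x hx => by rw [if_pos hx]
  rw [e]
  exact Integrable.fintype_prod (f := fun x u => Real.exp ((if x ∈ I then r else 0) * u))
    fun x => integrable_exp_mul_gaussianReal _

lemma exp_le_quadratic (z : ℝ) : Real.exp z ≤ 1 + z + z ^ 2 * Real.exp |z| := by
  have h := Complex.norm_exp_sub_sum_le_norm_mul_exp (z : ℂ) 2
  have e : Complex.exp z - ∑ m ∈ range 2, (z : ℂ) ^ m / (m.factorial : ℂ) =
      ((Real.exp z - (1 + z) : ℝ) : ℂ) := by
    simp [sum_range_succ]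
  rw [e, Complex.norm_real, Complex.norm_real, Real.norm_eq_abs, Real.norm_eq_abs, sq_abs] at h
  have := le_abs_self (Real.exp z - (1 + z))
  linarith

variable (m : (Fin n → ℝ) → ℝ) (I : Finset (Fin n))

/-- The Laplace transform of the sum over `I` under the density `m`. -/
noncomputable def laplace (r : ℝ) : ℝ := ∫ g, m g * Real.exp (-r * ∑ x ∈ I, g x) ∂gauss n

variable {m} (hc : Continuous m) (h0 : ∀ g, 0 < m g) (h1 : ∀ g, m g ≤ 1)
include hc h0 h1

lemma integrable_mul_of_density {f : (Fin n → ℝ) → ℝ} (hf : Integrable f (gauss n)) :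
    Integrable (fun g => m g * f g) (gauss n) :=
  hf.bdd_mul (c := 1) hc.aestronglyMeasurable (ae_of_all _ fun g => by
    rw [Real.norm_of_nonneg (h0 g).le]; exact h1 g)

omit hc h1 in
lemma laplace_nonneg (r : ℝ) : 0 ≤ laplace m I r :=
  integral_nonneg fun g => mul_nonneg (h0 g).le (Real.exp_nonneg _)

lemma laplace_mul_le (hm : ∀ g g', m g * m g' ≤ m (fun x => (g x + g' x) / 2) ^ 2) (r : ℝ) :
    laplace m I r * ∫ g, m g ∂gauss n ≤ laplace m I (r / 2) ^ 2 * Real.exp (r ^ 2 * #I / 4) := by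
  have hI : ∀ r, Integrable (fun g => m g * Real.exp (-r * ∑ x ∈ I, g x)) (gauss n) := fun r =>
    integrable_mul_of_density hc h0 h1 (integrable_exp_mul_sum I _)
  have hI0 : Integrable m (gauss n) := by
    simpa using integrable_mul_of_density hc h0 h1 (integrable_const (1:ℝ))
  have hn : ∀ r g, 0 ≤ m g * Real.exp (-r * ∑ x ∈ I, g x) := fun r g =>
    mul_nonneg (h0 g).le (Real.exp_nonneg _)
  have hmeas : ∀ r c : ℝ, Measurable fun g : Fin n → ℝ =>
      ENNReal.ofReal (m g * Real.exp (-r * ∑ x ∈ I, g x) * c) := fun r c =>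
    ENNReal.measurable_ofReal.comp (by fun_prop)
  have key := prekopaLeindler_gauss n (f := fun g => ENNReal.ofReal
      (m g * Real.exp (-r * ∑ x ∈ I, g x))) (g := fun g => ENNReal.ofReal (m g))
      (h := fun g => ENNReal.ofReal (m g * Real.exp (-(r / 2) * ∑ x ∈ I, g x) *
        Real.exp (r ^ 2 * #I / 8))) (by simpa using hmeas r 1) (by fun_prop) (hmeas _ _) ?_
  · rw [← ofReal_integral_eq_lintegral_ofReal (hI r) (ae_of_all _ (hn r)),
      ← ofReal_integral_eq_lintegral_ofReal hI0 (ae_of_all _ fun g => (h0 g).le),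
      ← ofReal_integral_eq_lintegral_ofReal ((hI (r / 2)).mul_const _)
        (ae_of_all _ fun g => mul_nonneg (hn _ g) (Real.exp_nonneg _)),
      ← ENNReal.ofReal_mul (integral_nonneg (hn r)), integral_mul_const,
      ← ENNReal.ofReal_pow (mul_nonneg (integral_nonneg (hn _)) (Real.exp_nonneg _)),
      ENNReal.ofReal_le_ofReal_iff (sq_nonneg _), mul_pow, ← Real.exp_nat_mul] at key
    refine key.trans_eq ?_
    congr 2
    push_cast; ring
  · intro x y
    simp only
    rw [← ENNReal.ofReal_mul (hn r x), ← ENNReal.ofReal_mul (mul_nonneg (hn r x) (h0 y).le),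
      ← ENNReal.ofReal_pow (mul_nonneg (hn _ _) (Real.exp_nonneg _))]
    refine ENNReal.ofReal_le_ofReal ?_
    have hxy := hm x y
    set c := m fun i => (x i + y i) / 2
    rw [mul_assoc c, ← Real.exp_add, mul_pow, ← Real.exp_nat_mul, mul_right_comm (m x),
      mul_assoc (m x * m y), ← Real.exp_add]
    refine mul_le_mul hxy (Real.exp_le_exp.2 ?_) (Real.exp_nonneg _) (sq_nonneg _)
    have a1 : ∑ i ∈ I, (x i - y i) ^ 2 ≤ ∑ i, (x i - y i) ^ 2 :=
      sum_le_sum_of_subset_of_nonneg (subset_univ _) fun _ _ _ => sq_nonneg _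
    have a2 : 0 ≤ ∑ i ∈ I, (x i - y i + r) ^ 2 := sum_nonneg fun _ _ => sq_nonneg _
    have a3 : ∑ i ∈ I, (x i - y i + r) ^ 2 = ∑ i ∈ I, (x i - y i) ^ 2 +
        2 * r * (∑ i ∈ I, x i - ∑ i ∈ I, y i) + #I * r ^ 2 := by
      rw [← sum_sub_distrib, mul_sum, ← sum_add_distrib, ← nsmul_eq_mul, ← sum_const,
        ← sum_add_distrib]
      exact sum_congr rfl fun i _ => by ring
    rw [← sum_div, ← sum_div, sum_add_distrib]
    push_cast
    linarith

lemma laplace_le_near_zero (s : ℝ) (hs : ∫ g, m g ∂gauss n = s) (r : ℝ) :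
    ∃ K : ℝ, ∀ u, 0 ≤ u → u ≤ r →
      laplace m I u ≤ s - u * (∑ x ∈ I, ∫ g, m g * g x ∂gauss n) + K * u ^ 2 := by
  have hE : ∀ c, Integrable (fun g : Fin n → ℝ => Real.exp (c * ∑ x ∈ I, g x)) (gauss n) :=
    integrable_exp_mul_sum I
  have hI0 : Integrable m (gauss n) := by
    simpa using integrable_mul_of_density hc h0 h1 (integrable_const (1:ℝ))
  have hIx : ∀ x, Integrable (fun g => m g * g x) (gauss n) := fun x =>
    integrable_mul_of_density hc h0 h1 (integrable_eval_gauss x)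
  refine ⟨∫ g, 2 * (Real.exp ((1 + r) * ∑ x ∈ I, g x) + Real.exp (-(1 + r) * ∑ x ∈ I, g x))
    ∂gauss n, fun u hu hur => ?_⟩
  have hK := ((hE (1 + r)).add (hE (-(1 + r)))).const_mul 2
  simp only [Pi.add_apply] at hK
  have hL : Integrable (fun g => m g - u * ∑ x ∈ I, m g * g x) (gauss n) :=
    hI0.sub ((integrable_finsetSum _ fun x _ => hIx x).const_mul u)
  rw [← hs, ← integral_finsetSum _ fun x _ => hIx x, ← integral_const_mul, ← integral_mul_const,
    ← integral_sub hI0 ((integrable_finsetSum _ fun x _ => hIx x).const_mul u),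
    ← integral_add hL (hK.mul_const _)]
  refine integral_mono (integrable_mul_of_density hc h0 h1 (hE _)) (hL.add (hK.mul_const _))
    fun g => ?_
  simp only [← mul_sum]
  set l := ∑ x ∈ I, g x
  have q := exp_le_quadratic (-u * l)
  have habs : |(-u * l)| ≤ r * |l| := by
    rw [abs_mul, abs_neg, abs_of_nonneg hu]
    exact mul_le_mul_of_nonneg_right hur (abs_nonneg _)
  have hsq : l ^ 2 ≤ 2 * Real.exp |l| := by
    have := Real.quadratic_le_exp_of_nonneg (abs_nonneg l)
    rw [sq_abs] at this
    have := abs_nonneg l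
    linarith
  have hexp : Real.exp ((1 + r) * |l|) ≤ Real.exp ((1 + r) * l) + Real.exp (-(1 + r) * l) := by
    rcases abs_cases l with ⟨h, _⟩ | ⟨h, _⟩ <;> rw [h]
    · linarith [Real.exp_nonneg (-(1 + r) * l)]
    · rw [mul_neg, ← neg_mul]
      linarith [Real.exp_nonneg ((1 + r) * l)]
  have hrem : (-u * l) ^ 2 * Real.exp |(-u * l)| ≤
      2 * (Real.exp ((1 + r) * l) + Real.exp (-(1 + r) * l)) * u ^ 2 := by
    calc (-u * l) ^ 2 * Real.exp |(-u * l)| ≤ (u ^ 2 * (2 * Real.exp |l|)) * Real.exp (r * |l|) := by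
          refine mul_le_mul ?_ (Real.exp_le_exp.2 habs) (Real.exp_nonneg _) (by positivity)
          rw [mul_pow, neg_sq]
          exact mul_le_mul_of_nonneg_left hsq (sq_nonneg u)
      _ = 2 * Real.exp ((1 + r) * |l|) * u ^ 2 := by
          rw [add_mul, one_mul, Real.exp_add]; ring
      _ ≤ _ := by
          refine mul_le_mul_of_nonneg_right ?_ (sq_nonneg u)
          linarith
  have hrem0 : 0 ≤ 2 * (Real.exp ((1 + r) * l) + Real.exp (-(1 + r) * l)) * u ^ 2 := by positivity
  have := mul_le_mul_of_nonneg_left (q.trans (add_le_add_right hrem _)) (h0 g).le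
  have h3 := mul_le_mul_of_nonneg_right (h1 g) hrem0
  linarith

lemma laplace_le (hm : ∀ g g', m g * m g' ≤ m (fun x => (g x + g' x) / 2) ^ 2) {t r : ℝ}
    (hr : 0 ≤ r)
    (ht : ∀ x ∈ I, t * ∫ g, m g ∂gauss n ≤ ∫ g, m g * g x ∂gauss n) :
    laplace m I r ≤ (∫ g, m g ∂gauss n) * Real.exp (-(r * t * #I) + r ^ 2 * #I / 2) := by
  set s := ∫ g, m g ∂gauss n with hs
  have hs0 : 0 < s := by
    have hI0 : Integrable m (gauss n) := by
      simpa using integrable_mul_of_density hc h0 h1 (integrable_const (1:ℝ))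
    rw [hs, integral_pos_iff_support_of_nonneg (fun g => (h0 g).le) hI0]
    have : Function.support m = Set.univ := Set.eq_univ_of_forall fun g => (h0 g).ne'
    rw [this]; simp
  set H : ℝ → ℝ := fun r => laplace m I r / s * Real.exp (-(r ^ 2 * #I / 2)) with hH
  have hH0 : ∀ r, 0 ≤ H r := fun r =>
    mul_nonneg (div_nonneg (laplace_nonneg I h0 r) hs0.le) (Real.exp_nonneg _)
  have hstep : ∀ r, H r ≤ H (r / 2) ^ 2 := by
    intro r
    have h2 := laplace_mul_le I hc h0 h1 hm r
    simp only [hH]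
    rw [mul_pow, div_pow, ← Real.exp_nat_mul]
    have e : Real.exp (((2:ℕ):ℝ) * -((r / 2) ^ 2 * #I / 2)) =
        Real.exp (r ^ 2 * #I / 4) * Real.exp (-(r ^ 2 * #I / 2)) := by
      rw [← Real.exp_add]; congr 1; push_cast; ring
    rw [e, ← mul_assoc]
    refine mul_le_mul_of_nonneg_right ?_ (Real.exp_nonneg _)
    rw [div_mul_eq_mul_div, div_le_div_iff₀ hs0 (by positivity)]
    nlinarith
  have hiter : ∀ k : ℕ, H r ≤ H (r / 2 ^ k) ^ 2 ^ k := by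
    intro k
    induction k with
    | zero => simp
    | succ k ih =>
      refine ih.trans ?_
      have e : r / 2 ^ (k + 1) = r / 2 ^ k / 2 := by rw [pow_succ, div_div]
      rw [e, pow_succ 2 k, mul_comm (2 ^ k) 2, pow_mul]
      exact pow_le_pow_left₀ (hH0 _) (hstep _) _
  obtain ⟨K, hK⟩ := laplace_le_near_zero I hc h0 h1 s rfl r
  have hbound : ∀ k : ℕ, H r ≤ Real.exp (-(r * t * #I) + |K| / s * r ^ 2 * (1 / 2) ^ k) := by
    intro k
    set u := r / 2 ^ k with hu
    have hu0 : 0 ≤ u := by positivity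
    have hur : u ≤ r := div_le_self hr (one_le_pow₀ (by norm_num))
    have h2 := hK u hu0 hur
    have h3 : t * s * #I ≤ ∑ x ∈ I, ∫ g, m g * g x ∂gauss n := by
      have := sum_le_sum ht
      rw [sum_const, nsmul_eq_mul] at this
      linarith
    have h4 : H u ≤ Real.exp (-(u * t * #I) + |K| / s * u ^ 2) := by
      have h5 : laplace m I u / s ≤ -(u * t * #I) + |K| / s * u ^ 2 + 1 := by
        rw [div_le_iff₀ hs0]
        have h6 := mul_le_mul_of_nonneg_left h3 hu0
        have h7 := mul_le_mul_of_nonneg_right (le_abs_self K) (sq_nonneg u)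
        have e : (-(u * t * #I) + |K| / s * u ^ 2 + 1) * s =
          -(u * (t * s * #I)) + |K| * u ^ 2 + s := by field_simp
        rw [e]
        linarith
      calc H u ≤ laplace m I u / s * 1 := by
            refine mul_le_mul_of_nonneg_left ?_ (div_nonneg (laplace_nonneg I h0 u) hs0.le)
            rw [Real.exp_le_one_iff]
            have : 0 ≤ u ^ 2 * #I / 2 := by positivity
            linarith
        _ ≤ -(u * t * #I) + |K| / s * u ^ 2 + 1 := by rwa [mul_one]
        _ ≤ _ := Real.add_one_le_exp _
    refine (hiter k).trans ((pow_le_pow_left₀ (hH0 _) h4 _).trans_eq ?_)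
    rw [← Real.exp_nat_mul]
    congr 1
    push_cast
    rw [hu, one_div, inv_pow]
    field_simp
  have hlim : Filter.Tendsto (fun k : ℕ => Real.exp (-(r * t * #I) +
      |K| / s * r ^ 2 * (1 / 2) ^ k)) Filter.atTop (nhds (Real.exp (-(r * t * #I)))) := by
    refine (Real.continuous_exp.tendsto _).comp ?_
    have := tendsto_pow_atTop_nhds_zero_of_lt_one (r := (1/2:ℝ)) (by norm_num) (by norm_num)
    simpa using (this.const_mul (|K| / s * r ^ 2)).const_add (-(r * t * #I))
  have hfin : H r ≤ Real.exp (-(r * t * #I)) := ge_of_tendsto' hlim hbound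
  simp only [hH] at hfin
  rw [Real.exp_neg (r ^ 2 * #I / 2), ← div_eq_mul_inv, div_le_iff₀ (Real.exp_pos _), ← Real.exp_add,
    div_le_iff₀ hs0] at hfin
  linarith

/-- Under a log-concave density whose barycentre is large on `I`, it is unlikely that all
coordinates in `I` are small. -/
lemma integral_indicator_le (hm : ∀ g g', m g * m g' ≤ m (fun x => (g x + g' x) / 2) ^ 2) {t : ℝ}
    (ht0 : 0 ≤ t)
    (ht : ∀ x ∈ I, t * ∫ g, m g ∂gauss n ≤ ∫ g, m g * g x ∂gauss n) :
    ∫ g, (if ∀ x ∈ I, g x ≤ t / 2 then m g else 0) ∂gauss n ≤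
      (∫ g, m g ∂gauss n) * Real.exp (-(t ^ 2 * #I / 8)) := by
  have h2 := laplace_le I hc h0 h1 hm (r := t / 2) (by linarith) ht
  have h3 : ∫ g, (if ∀ x ∈ I, g x ≤ t / 2 then m g else 0) ∂gauss n ≤
      laplace m I (t / 2) * Real.exp (t ^ 2 * #I / 4) := by
    rw [laplace, ← integral_mul_const]
    refine integral_mono_of_nonneg (ae_of_all _ fun g => ?_)
      ((integrable_mul_of_density hc h0 h1 (integrable_exp_mul_sum I _)).mul_const _)
      (ae_of_all _ fun g => ?_)
    · simp only [Pi.zero_apply]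
      split_ifs
      exacts [(h0 g).le, le_rfl]
    · simp only
      split_ifs with hg
      · rw [mul_assoc, ← Real.exp_add]
        refine le_mul_of_one_le_right (h0 g).le (Real.one_le_exp ?_)
        have : ∑ x ∈ I, g x ≤ #I * (t / 2) := by
          have := sum_le_sum hg
          rwa [sum_const, nsmul_eq_mul] at this
        nlinarith
      · exact mul_nonneg (mul_nonneg (h0 g).le (Real.exp_nonneg _)) (Real.exp_nonneg _)
  refine h3.trans ((mul_le_mul_of_nonneg_right h2 (Real.exp_nonneg _)).trans_eq ?_)
  rw [mul_assoc, ← Real.exp_add]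
  congr 2
  ring

end LaplaceTransform

section Kernel

open MeasureTheory ProbabilityTheory

variable {ι : Type*} [Fintype ι] {n : ℕ}

/-- A family of sub-probability kernels `K i`, jointly dominated by the `p`-biased measure, such
that under `K i` each part `I` of `R i` is missed with probability at most `q ^ #I`. -/
structure IsHitting (R : ι → Finset (Fin n)) (p q : ℝ) (K : ι → Finset (Fin n) → ℝ) : Prop where
  nonneg : ∀ i W, 0 ≤ K i W
  sum_le : ∀ W, ∑ i, K i W ≤ wt p W
  pos : ∀ i, 0 < ∑ W, K i W
  miss : ∀ i, ∀ I ⊆ R i, ∑ W with Disjoint W I, K i W ≤ q ^ #I * ∑ W, K i W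

lemma IsHitting.sum_sum_le_one {R : ι → Finset (Fin n)} {p q : ℝ} {K : ι → Finset (Fin n) → ℝ}
    (hK : IsHitting R p q K) : ∑ i, ∑ W, K i W ≤ 1 := by
  rw [sum_comm]
  exact (sum_le_sum fun W _ => hK.sum_le W).trans_eq (sum_wt p)

lemma exists_isHitting (R : ι → Finset (Fin n)) {t : ℝ} (ht : 0 ≤ t)
    (hs : tail (2 * t + 2) ≤ 1 / 2) {ν : ι → ℝ} (hν : ∀ i, 0 < ν i) {B : ℝ} (hB : 0 ≤ B) :
    ∃ (h : ι → Fin n → ℝ) (b : ι → ℝ) (K : ι → Finset (Fin n) → ℝ),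
      (∀ i x, 0 ≤ h i x) ∧ (∀ i, b i ≤ B) ∧
      IsHitting R (tail (t / 2)) (Real.exp (-(t ^ 2 / 8))) K ∧
      (∀ i, ∑ W, K i W ≤ ν i) ∧ (∀ i, b i < B → ∑ W, K i W = ν i) ∧
      ∀ y : Finset (Fin n) → ℝ,
        (∀ S, y S ≤ 0 ∨ ∃ i, Good (h i) (R i) S ∧ y S ≤ b i) →
        ∑ S, wt (tail (2 * t + 2)) S * y S ≤
          ∑ i, b i * ∑ W, K i W + Real.log (1 + Fintype.card ι) := by
  obtain ⟨h, b, m, hh, hb, hmc, hm0, hm1, hmm, hle, heq, hbar, hy⟩ := exists_dual R ht hs hν hB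
  have hm1' : ∀ i g, m i g ≤ 1 := fun i g =>
    (single_le_sum (fun i _ => (hm0 i g).le) (mem_univ i)).trans (hm1 g)
  have hI0 : ∀ i, Integrable (m i) (gauss n) := fun i => by
    simpa using integrable_mul_of_density (hmc i) (hm0 i) (hm1' i) (integrable_const (1:ℝ))
  have hI : ∀ i W, Integrable (fun g => layInd (t / 2) W g * m i g) (gauss n) := fun i W =>
    integrable_layInd_mul _ _ (hI0 i)
  have hL : ∀ W, Integrable (layInd (t / 2) W) (gauss n) := fun W => by
    simpa using integrable_layInd_mul (t / 2) W (integrable_const (1:ℝ) (μ := gauss n))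
  set K : ι → Finset (Fin n) → ℝ := fun i W => ∫ g, layInd (t / 2) W g * m i g ∂gauss n with hK
  have hsum : ∀ i, ∑ W, K i W = mass (m) i := by
    intro i
    simp only [hK, mass]
    rw [← integral_finsetSum _ fun W _ => hI i W]
    refine integral_congr_ae (ae_of_all _ fun g => ?_)
    simp only
    rw [← sum_mul, sum_layInd, one_mul]
  refine ⟨h, b, K, hh, hb, ⟨fun i W => ?_, fun W => ?_, fun i => ?_, fun i I hIR => ?_⟩,
    fun i => (hsum i).trans_le (hle i), fun i hi => (hsum i).trans (heq i hi), ?_⟩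
  · exact integral_nonneg fun g => mul_nonneg (layInd_nonneg _ _ _) (hm0 i g).le
  · simp only [hK]
    rw [← integral_layInd, ← integral_finsetSum _ fun i _ => hI i W]
    refine integral_mono (integrable_finsetSum _ fun i _ => hI i W) (hL W) fun g => ?_
    simp only
    rw [← mul_sum]
    exact mul_le_of_le_one_right (layInd_nonneg _ _ _) (hm1 g)
  · rw [hsum, mass, integral_pos_iff_support_of_nonneg (fun g => (hm0 i g).le) (hI0 i)]
    have : Function.support (m i) = Set.univ := Set.eq_univ_of_forall fun g => (hm0 i g).ne'
    rw [this]; simp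
  · rw [hsum]
    have h2 := integral_indicator_le I (hmc i) (hm0 i) (hm1' i) (hmm i) ht fun x hx =>
      hbar i x (hIR hx)
    rw [mass, ← Real.exp_nat_mul, mul_comm]
    refine le_trans (le_of_eq ?_) (h2.trans_eq ?_)
    · simp only [hK]
      rw [← integral_finsetSum _ fun W _ => hI i W]
      refine integral_congr_ae (ae_of_all _ fun g => ?_)
      simp only [layInd, ite_mul, one_mul, zero_mul]
      rw [sum_ite_eq]
      refine if_congr ?_ rfl rfl
      simp only [mem_filter, mem_univ, true_and]
      rw [disjoint_right]
      simp only [mem_layer, not_lt]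
    · congr 2
      ring
  · simpa only [hsum] using hy

lemma max_sub_eq_integral {a y B : ℝ} (hy : 0 ≤ y) (ha : a ≤ B) :
    max (a - y) 0 = ∫ r in Set.Ioc 0 B, (Set.Ioc y a).indicator (fun _ => (1:ℝ)) r := by
  rw [setIntegral_indicator measurableSet_Ioc, Set.inter_eq_self_of_subset_right
    (Set.Ioc_subset_Ioc hy ha)]
  simp

lemma tail_bounds {t : ℝ} (ht : 8 ≤ t) :
    Real.exp (-(3 * t ^ 2)) ≤ tail (2 * t + 2) ∧ tail (2 * t + 2) ≤ 1 / 2 := by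
  constructor
  · refine le_trans (Real.exp_le_exp.2 ?_) (le_tail (by linarith))
    nlinarith
  · refine (tail_le (by linarith)).trans ?_
    have h1 : Real.exp (-((2 * t + 2) ^ 2 / 2)) ≤ Real.exp (-1) := Real.exp_le_exp.2 (by nlinarith)
    have h2 := Real.exp_neg_one_lt_half
    linarith

lemma exp_ratio_bounds {t : ℝ} (ht : 8 ≤ t) :
    64 * Real.exp (-(20 * t ^ 2)) ≤ tail (2 * t + 2) ∧
    18 * (Real.exp (-(20 * t ^ 2)) / tail (2 * t + 2)) + Real.exp (-(17 * t ^ 2)) ≤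
      Real.exp (-(16 * t ^ 2)) := by
  have h1 := (tail_bounds ht).1
  have h64 : (64:ℝ) ≤ Real.exp (t ^ 2) := by
    have := Real.add_one_le_exp (t ^ 2)
    nlinarith
  have h64' : (64:ℝ) ≤ Real.exp (17 * t ^ 2) :=
    h64.trans (Real.exp_le_exp.2 (by nlinarith [sq_nonneg t]))
  have e1 : Real.exp (-(3 * t ^ 2)) = Real.exp (17 * t ^ 2) * Real.exp (-(20 * t ^ 2)) := by
    rw [← Real.exp_add]; congr 1; ring
  have e2 : Real.exp (-(16 * t ^ 2)) = Real.exp (t ^ 2) * Real.exp (-(17 * t ^ 2)) := by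
    rw [← Real.exp_add]; congr 1; ring
  have e3 : Real.exp (-(20 * t ^ 2)) = Real.exp (-(17 * t ^ 2)) * Real.exp (-(3 * t ^ 2)) := by
    rw [← Real.exp_add]; congr 1; ring
  constructor
  · refine le_trans ?_ h1
    rw [e1]
    exact mul_le_mul_of_nonneg_right h64' (Real.exp_nonneg _)
  · have : Real.exp (-(20 * t ^ 2)) / tail (2 * t + 2) ≤ Real.exp (-(17 * t ^ 2)) := by
      rw [div_le_iff₀ ((Real.exp_pos _).trans_le h1), e3]
      exact mul_le_mul_of_nonneg_left h1 (Real.exp_nonneg _)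
    rw [e2]
    nlinarith [Real.exp_pos (-(17 * t ^ 2))]

lemma exists_large_slope (c : ℝ) {δ : ℝ} (hδ : 0 < δ) : ∃ B : ℝ, 0 < B ∧ c ≤ B * δ :=
  ⟨|c| / δ + 1, by positivity, by
    rw [add_mul, div_mul_cancel₀ _ hδ.ne']
    linarith [le_abs_self c]⟩

/-- Almost all of a spread probability vector is transported by a hitting family. -/
theorem exists_isHitting_of_spread (R : ι → Finset (Fin n)) {t : ℝ} (ht : 8 ≤ t) {ν : ι → ℝ}
    (hν : ∀ i, 0 < ν i) (hν1 : ∑ i, ν i = 1)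
    (hsp : ∀ I : Finset (Fin n), ∑ i with I ⊆ R i, ν i ≤ Real.exp (-(20 * t ^ 2)) ^ #I) :
    ∃ K, IsHitting R (tail (t / 2)) (Real.exp (-(t ^ 2 / 8))) K ∧ (∀ i, ∑ W, K i W ≤ ν i) ∧
      ∑ i, (ν i - ∑ W, K i W) ≤ Real.exp (-(16 * t ^ 2)) := by
  classical
  obtain ⟨B, hB, hBlog⟩ := exists_large_slope (Real.log (1 + Fintype.card ι))
    (Real.exp_pos (-(17 * t ^ 2)))
  have htail := tail_bounds ht
  have htp : 0 < tail (2 * t + 2) := (Real.exp_pos _).trans_le htail.1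
  obtain ⟨h, b, K, hh, hb, hK, hle, heq, hy⟩ := exists_isHitting R (by linarith) htail.2 hν hB.le
  refine ⟨K, hK, hle, ?_⟩
  have hex : ∀ W, ∃ y : ℝ, 0 ≤ y ∧ (y ≤ 0 ∨ ∃ i, Good (h i) (R i) W ∧ y ≤ b i) ∧
      ∀ i, Good (h i) (R i) W → b i ≤ y := by
    intro W
    by_cases hne : (univ.filter fun i => Good (h i) (R i) W).Nonempty
    · obtain ⟨i, hi, hmax⟩ := exists_max_image _ b hne
      have hi' := (mem_filter.1 hi).2
      refine ⟨max 0 (b i), le_max_left _ _, ?_, fun j hj =>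
        (hmax j (mem_filter.2 ⟨mem_univ _, hj⟩)).trans (le_max_right _ _)⟩
      rcases le_total (b i) 0 with h0 | h0
      · exact Or.inl (max_eq_left h0).le
      · exact Or.inr ⟨i, hi', (max_eq_right h0).le⟩
    · refine ⟨0, le_rfl, Or.inl le_rfl, fun i hi => absurd ⟨i, ?_⟩ hne⟩
      exact mem_filter.2 ⟨mem_univ _, hi⟩
  choose y hy0 hy1 hy2 using hex
  set p := tail (2 * t + 2)
  set ε := Real.exp (-(20 * t ^ 2)) with hε
  have hw : ∀ W : Finset (Fin n), 0 ≤ wt p W := wt_nonneg htp.le (tail_le_one _)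
  have hlevel : ∀ r : ℝ, 0 < r → ∑ i, ∑ W, ν i * wt p W *
      (Set.Ioc (y W) (b i)).indicator (fun _ => (1:ℝ)) r ≤ 9 * (ε / p) := by
    intro r hr
    have h1 := bad_mul_mass_le (X := univ.filter fun i => r ≤ b i) (R := R) hh htp (tail_le_one _)
      (Real.exp_nonneg _) (exp_ratio_bounds ht).1 (fun i => (hν i).le) (fun I => ?_)
      (fun W => if y W < r then 1 else 0) (fun W => ?_) fun W i hi hg => ?_
    · refine le_trans (le_of_eq ?_) h1
      rw [mul_comm, sum_mul_sum, sum_filter]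
      refine sum_congr rfl fun i _ => ?_
      split_ifs with hi
      · refine sum_congr rfl fun W _ => ?_
        simp only [Set.indicator_apply, Set.mem_Ioc, hi, and_true, mul_assoc]
      · refine sum_eq_zero fun W _ => ?_
        simp [hi]
    · refine le_trans (sum_le_sum_of_subset_of_nonneg (fun i hi => ?_)
        fun i _ _ => (hν i).le) (hsp I)
      exact mem_filter.2 ⟨mem_univ _, (mem_filter.1 hi).2⟩
    · split_ifs <;> norm_num
    · have := hy2 W i hg
      rw [if_neg (by have := (mem_filter.1 hi).2; linarith)]
  have hmain : ∑ i, ν i * max (b i) 0 - ∑ W, wt p W * y W ≤ B * (9 * (ε / p)) := by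
    have e : ∑ i, ν i * max (b i) 0 - ∑ W, wt p W * y W =
        ∑ i, ∑ W, ν i * wt p W * (max (b i) 0 - y W) := by
      have e1 : ∑ i, ν i * max (b i) 0 = ∑ i, ∑ W : Finset (Fin n), ν i * wt p W * max (b i) 0 := by
        refine sum_congr rfl fun i _ => ?_
        rw [← sum_mul, ← mul_sum, sum_wt, mul_one]
      have e2 : ∑ W, wt p W * y W = ∑ i, ∑ W, ν i * wt p W * y W := by
        rw [sum_comm]
        refine sum_congr rfl fun W _ => ?_
        rw [← sum_mul, ← sum_mul, hν1, one_mul]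
      rw [e1, e2, ← sum_sub_distrib]
      refine sum_congr rfl fun i _ => ?_
      rw [← sum_sub_distrib]
      exact sum_congr rfl fun W _ => by ring
    have hint : ∀ i W, IntegrableOn (fun r => ν i * wt p W *
        (Set.Ioc (y W) (b i)).indicator (fun _ => (1:ℝ)) r) (Set.Ioc 0 B) := fun i W =>
      ((integrable_const (1:ℝ)).indicator measurableSet_Ioc).const_mul _
    calc _ = ∑ i, ∑ W, ν i * wt p W * (max (b i) 0 - y W) := e
      _ ≤ ∑ i, ∑ W, ν i * wt p W * max (b i - y W) 0 := by
          refine sum_le_sum fun i _ => sum_le_sum fun W _ =>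
            mul_le_mul_of_nonneg_left ?_ (mul_nonneg (hν i).le (hw W))
          rcases le_total (b i) 0 with h0 | h0
          · rw [max_eq_right h0]
            have := hy0 W
            exact (by linarith : 0 - y W ≤ 0).trans (le_max_right _ _)
          · rw [max_eq_left h0]
            exact le_max_left _ _
      _ = ∫ r in Set.Ioc 0 B, ∑ i, ∑ W, ν i * wt p W *
          (Set.Ioc (y W) (b i)).indicator (fun _ => (1:ℝ)) r := by
          rw [integral_finsetSum _ fun i _ => integrable_finsetSum _ fun W _ => hint i W]
          refine sum_congr rfl fun i _ => ?_
          rw [integral_finsetSum _ fun W _ => hint i W]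
          refine sum_congr rfl fun W _ => ?_
          rw [integral_const_mul, max_sub_eq_integral (hy0 W) (hb i)]
      _ ≤ ∫ _r in Set.Ioc 0 B, 9 * (ε / p) := by
          refine setIntegral_mono_on (integrable_finsetSum _ fun i _ =>
            integrable_finsetSum _ fun W _ => hint i W) (integrable_const _) measurableSet_Ioc
            fun r hr => hlevel r hr.1
      _ = B * (9 * (ε / p)) := by simp [hB.le]
  have h1 := hy y hy1
  have h2 : ∑ i, b i * ∑ W, K i W ≤ ∑ i, ν i * max (b i) 0 - B * ∑ i, (ν i - ∑ W, K i W) := by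
    rw [mul_sum, ← sum_sub_distrib]
    refine sum_le_sum fun i _ => ?_
    rcases eq_or_lt_of_le (hb i) with hbi | hbi
    · rw [hbi, max_eq_left hB.le]
      exact le_of_eq (by ring)
    · rw [heq i hbi]
      nlinarith [le_max_left (b i) 0, hν i]
  have h3 : B * ∑ i, (ν i - ∑ W, K i W) ≤ B * (9 * (ε / p) + Real.exp (-(17 * t ^ 2))) := by
    rw [mul_add]; linarith
  have h4 := le_of_mul_le_mul_left h3 hB
  have h5 := (exp_ratio_bounds ht).2
  have h6 : 0 ≤ ε / p := div_nonneg (Real.exp_nonneg _) htp.le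
  linarith

/-- A family which is not small admits a hitting family of nearly full mass. -/
theorem exists_isHitting_of_not_small (R : ι → Finset (Fin n)) {t : ℝ} (ht : 8 ≤ t)
    (hns : ∀ 𝒯 : Finset (Finset (Fin n)), (∀ i, ∃ T ∈ 𝒯, T ⊆ R i) →
      1 / 2 ≤ ∑ T ∈ 𝒯, Real.exp (-(20 * t ^ 2)) ^ #T) :
    ∃ K, IsHitting R (tail (t / 2)) (Real.exp (-(t ^ 2 / 8))) K ∧
      1 - Real.exp (-(16 * t ^ 2)) ≤ ∑ i, ∑ W, K i W := by
  classical
  obtain ⟨B, hB, hBlog⟩ := exists_large_slope (Real.log (1 + Fintype.card ι))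
    (Real.exp_pos (-(17 * t ^ 2)))
  have htail := tail_bounds ht
  have htp : 0 < tail (2 * t + 2) := (Real.exp_pos _).trans_le htail.1
  obtain ⟨h, b, K, hh, hb, hK, -, heq, hy⟩ := exists_isHitting R (by linarith) htail.2
    (ν := fun _ => 2) (fun _ => two_pos) hB.le
  refine ⟨K, hK, ?_⟩
  have hbB : ∀ i, b i = B := fun i => by
    refine (hb i).eq_or_lt.resolve_right fun hlt => ?_
    have h1 := heq i hlt
    have h2 := single_le_sum (f := fun i => ∑ W, K i W)
      (fun i _ => sum_nonneg fun W _ => hK.nonneg i W) (mem_univ i)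
    have h3 := hK.sum_sum_le_one
    linarith
  have h1 := bad_le_of_not_small (X := univ) (R := R) hh htp (tail_le_one _)
    (Real.exp_nonneg _) (exp_ratio_bounds ht).1 (fun 𝒯 h𝒯 => hns 𝒯 fun i => h𝒯 i (mem_univ i))
    (fun W => if ∃ i, Good (h i) (R i) W then 0 else 1) (fun W => by split_ifs <;> norm_num)
    fun W i _ hg => by rw [if_pos ⟨i, hg⟩]
  have h2 := hy (fun W => if ∃ i, Good (h i) (R i) W then B else 0) fun W => by
    split_ifs with hg
    · obtain ⟨i, hi⟩ := hg
      exact Or.inr ⟨i, hi, (hbB i).ge⟩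
    · exact Or.inl le_rfl
  have h3 : ∑ W, wt (tail (2 * t + 2)) W * (if ∃ i, Good (h i) (R i) W then B else 0) =
      B * (1 - ∑ W, wt (tail (2 * t + 2)) W * if ∃ i, Good (h i) (R i) W then 0 else 1) := by
    have e : ∑ W : Finset (Fin n), wt (tail (2 * t + 2)) W * B = B := by
      rw [← sum_mul, sum_wt, one_mul]
    rw [mul_sub, mul_one, eq_sub_iff_add_eq, mul_sum, ← sum_add_distrib]
    refine Eq.trans (sum_congr rfl fun W _ => ?_) e
    split_ifs <;> ring
  have h4 : B * (1 - 18 * (Real.exp (-(20 * t ^ 2)) / tail (2 * t + 2)) -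
      Real.exp (-(17 * t ^ 2))) ≤ B * ∑ i, ∑ W, K i W := by
    simp only [hbB, ← mul_sum] at h2
    rw [h3] at h2
    nlinarith
  have h5 := le_of_mul_le_mul_left h4 hB
  have h6 := (exp_ratio_bounds ht).2
  linarith

end Kernel

section Transport

variable {ι : Type*} [Fintype ι] {n : ℕ}

/-- Normalized version of `IsHitting`: probability kernels `κ i` with masses `s i`. -/
structure IsTransport (R : ι → Finset (Fin n)) (p q : ℝ) (s : ι → ℝ)
    (κ : ι → Finset (Fin n) → ℝ) : Prop where
  mass_nonneg : ∀ i, 0 ≤ s i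
  nonneg : ∀ i W, 0 ≤ κ i W
  sum_eq_one : ∀ i, ∑ W, κ i W = 1
  sum_le : ∀ W, ∑ i, s i * κ i W ≤ wt p W
  miss : ∀ i, ∀ I ⊆ R i, ∑ W with Disjoint W I, κ i W ≤ q ^ #I

lemma IsHitting.isTransport {R : ι → Finset (Fin n)} {p q : ℝ} {K : ι → Finset (Fin n) → ℝ}
    (hK : IsHitting R p q K) :
    IsTransport R p q (fun i => ∑ W, K i W) fun i W => K i W / ∑ W, K i W where
  mass_nonneg i := (hK.pos i).le
  nonneg i W := div_nonneg (hK.nonneg i W) (hK.pos i).le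
  sum_eq_one i := by rw [← sum_div, div_self (hK.pos i).ne']
  sum_le W := by
    refine le_trans (le_of_eq (sum_congr rfl fun i _ => ?_)) (hK.sum_le W)
    rw [mul_div_cancel₀ _ (hK.pos i).ne']
  miss i I hI := by
    rw [← sum_div, div_le_iff₀ (hK.pos i)]
    exact hK.miss i I hI

lemma IsTransport.sum_mass {R : ι → Finset (Fin n)} {p q : ℝ} {s : ι → ℝ}
    {κ : ι → Finset (Fin n) → ℝ} (h : IsTransport R p q s κ) : ∑ i, s i ≤ 1 := by
  have : ∑ i, s i = ∑ W, ∑ i, s i * κ i W := by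
    rw [sum_comm]
    exact sum_congr rfl fun i _ => by rw [← mul_sum, h.sum_eq_one, mul_one]
  rw [this]
  exact (sum_le_sum fun W _ => h.sum_le W).trans_eq (sum_wt p)

lemma sum_subtype_eq_of_support {P : ι → Prop} [DecidablePred P] {f : ι → ℝ}
    (hf : ∀ i, ¬ P i → f i = 0) : ∑ i : {i // P i}, f i = ∑ i, f i := by
  rw [← sum_subtype (univ.filter P) (by simp) f]
  exact sum_filter_of_ne fun i _ hi => by_contra fun h => hi (hf i h)

lemma exists_isTransport_of_spread (R : ι → Finset (Fin n)) {t : ℝ} (ht : 8 ≤ t) {ν : ι → ℝ}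
    (hν : ∀ i, 0 ≤ ν i) (hν1 : ∑ i, ν i = 1)
    (hsp : ∀ I : Finset (Fin n), ∑ i with I ⊆ R i, ν i ≤ Real.exp (-(20 * t ^ 2)) ^ #I) :
    ∃ s κ, IsTransport R (tail (t / 2)) (Real.exp (-(t ^ 2 / 8))) s κ ∧ (∀ i, s i ≤ ν i) ∧
      ∑ i, (ν i - s i) ≤ Real.exp (-(16 * t ^ 2)) := by
  classical
  have h0 : ∀ i, ¬ 0 < ν i → ν i = 0 := fun i hi => le_antisymm (not_lt.1 hi) (hν i)
  obtain ⟨K, hK, hle, hloss⟩ := exists_isHitting_of_spread (fun i : {i // 0 < ν i} => R i) ht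
    (ν := fun i => ν i) (fun i => i.2) ((sum_subtype_eq_of_support h0).trans hν1) fun I => by
      refine le_trans (le_of_eq ?_) (hsp I)
      rw [sum_filter, sum_filter]
      exact sum_subtype_eq_of_support (f := fun i => if I ⊆ R i then ν i else 0)
        fun i hi => by rw [h0 i hi, ite_self]
  have hT := hK.isTransport
  set s : ι → ℝ := fun i => if h : 0 < ν i then ∑ W, K ⟨i, h⟩ W else 0 with hs
  set κ : ι → Finset (Fin n) → ℝ := fun i W =>
    if h : 0 < ν i then K ⟨i, h⟩ W / ∑ W, K ⟨i, h⟩ W else if W = univ then 1 else 0 with hκ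
  have hs1 : ∀ i : {i // 0 < ν i}, s i = ∑ W, K i W := fun i => by simp [hs, i.2]
  have hκ1 : ∀ (i : {i // 0 < ν i}) W, κ i W = K i W / ∑ W, K i W := fun i W => by simp [hκ, i.2]
  have hs0 : ∀ i, ¬ 0 < ν i → s i = 0 := fun i hi => by simp [hs, hi]
  have hκ0 : ∀ i W, ¬ 0 < ν i → κ i W = if W = univ then 1 else 0 := fun i W hi => by
    simp [hκ, hi]
  refine ⟨s, κ, ⟨fun i => ?_, fun i W => ?_, fun i => ?_, fun W => ?_, fun i I hI => ?_⟩,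
    fun i => ?_, ?_⟩
  · by_cases hi : 0 < ν i
    · rw [hs1 ⟨i, hi⟩]; exact hT.mass_nonneg _
    · rw [hs0 i hi]
  · by_cases hi : 0 < ν i
    · rw [hκ1 ⟨i, hi⟩]; exact hT.nonneg _ _
    · rw [hκ0 i W hi]; split_ifs <;> norm_num
  · by_cases hi : 0 < ν i
    · simp_rw [hκ1 ⟨i, hi⟩]; exact hT.sum_eq_one _
    · simp [hκ0 i _ hi]
  · rw [← sum_subtype_eq_of_support (P := fun i => 0 < ν i) (f := fun i => s i * κ i W)
      fun i hi => by rw [hs0 i hi, zero_mul]]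
    simp_rw [hs1, hκ1]
    exact hT.sum_le W
  · by_cases hi : 0 < ν i
    · simp_rw [hκ1 ⟨i, hi⟩]; exact hT.miss ⟨i, hi⟩ I hI
    · simp_rw [hκ0 i _ hi]
      rcases eq_or_ne I ∅ with rfl | hne
      · simp
      · have : ∑ W with Disjoint W I, (if W = univ then (1 : ℝ) else 0) = 0 := by
          refine sum_eq_zero fun W hW => if_neg ?_
          rintro rfl
          exact hne (disjoint_self.1 ((mem_filter.1 hW).2.mono_left (subset_univ I)))
        rw [this]
        positivity
  · by_cases hi : 0 < ν i
    · rw [hs1 ⟨i, hi⟩]; exact hle _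
    · rw [hs0 i hi]; exact hν i
  · rw [← sum_subtype_eq_of_support (P := fun i => 0 < ν i) fun i hi => by
      rw [hs0 i hi, h0 i hi, sub_zero]]
    simp_rw [hs1]
    exact hloss

end Transport

section Recursion

lemma sum_pi_marginal {α β : Type*} [Fintype α] [DecidableEq α] [Fintype β] {φ : β → ℝ}
    (hφ : ∑ b, φ b = 1) (j : α) (F : β → ℝ) :
    ∑ c : α → β, (∏ x, φ (c x)) * F (c j) = ∑ b, φ b * F b := by
  have h := prod_univ_sum (fun _ : α => (univ : Finset β))
    fun x b => φ b * if x = j then F b else 1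
  rw [Fintype.piFinset_univ] at h
  have h1 : ∀ c : α → β, (∏ x, φ (c x)) * F (c j) =
      ∏ x, (φ (c x) * if x = j then F (c x) else 1) := fun c => by
    rw [prod_mul_distrib, prod_ite_eq']
    simp
  rw [sum_congr rfl fun c _ => h1 c, ← h, prod_eq_single j]
  · simp
  · intro x _ hx
    simpa [hx] using hφ
  · simp

variable {n : ℕ} (D : Set (Finset (Fin n))) {k : ℕ}

/-- Probability that the union of `S` and a `τ`-biased random set is not in `D`. -/
noncomputable def escape (τ : ℝ) (S : Finset (Fin n)) : ℝ :=
  ∑ W, wt τ W * Dᶜ.indicator (1 : Finset (Fin n) → ℝ) (S ∪ W)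

/-- Sets covered by `2 * k` members of `D` which extend the prescribed sets `E j` and `O j`. -/
def coverable (E O : Fin k → Finset (Fin n)) : Set (Finset (Fin n)) :=
  {R | ∃ V W : Fin k → Finset (Fin n), (∀ j, V j ∈ D) ∧ (∀ j, W j ∈ D) ∧ (∀ j, E j ⊆ V j) ∧
    (∀ j, O j ⊆ W j) ∧ ∀ x ∈ R, ∃ j, x ∈ V j ∨ x ∈ W j}

/-- Indicator that `R` is not coverable. -/
noncomputable def fail (E O : Fin k → Finset (Fin n)) : Finset (Fin n) → ℝ :=
  (coverable D E O)ᶜ.indicator 1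

variable {D}

lemma compl_indicator_le_one {α : Type*} (s : Set α) (a : α) :
    sᶜ.indicator (1 : α → ℝ) a ≤ 1 :=
  Set.indicator_le_self' (fun _ _ => zero_le_one) a

lemma compl_indicator_nonneg {α : Type*} (s : Set α) (a : α) :
    0 ≤ sᶜ.indicator (1 : α → ℝ) a :=
  Set.indicator_nonneg (fun _ _ => zero_le_one) a

lemma monotone_compl_indicator (hD : IsLowerSet D) :
    Monotone (Dᶜ.indicator (1 : Finset (Fin n) → ℝ)) := by
  intro S T hST
  by_cases hS : S ∈ D
  · rw [Set.indicator_of_notMem (by simpa using hS)]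
    exact compl_indicator_nonneg _ _
  · have hT : T ∉ D := fun h => hS (hD hST h)
    rw [Set.indicator_of_mem hS, Set.indicator_of_mem hT, Pi.one_apply, Pi.one_apply]

lemma fail_nonneg (E O : Fin k → Finset (Fin n)) (R : Finset (Fin n)) : 0 ≤ fail D E O R :=
  compl_indicator_nonneg _ _

lemma fail_le_one (E O : Fin k → Finset (Fin n)) (R : Finset (Fin n)) : fail D E O R ≤ 1 :=
  compl_indicator_le_one _ _

lemma escape_nonneg {τ : ℝ} (h0 : 0 ≤ τ) (h1 : τ ≤ 1) (S : Finset (Fin n)) :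
    0 ≤ escape D τ S :=
  sum_nonneg fun W _ => mul_nonneg (wt_nonneg h0 h1 W) (compl_indicator_nonneg _ _)

lemma indicator_le_escape (hD : IsLowerSet D) {τ : ℝ} (h0 : 0 ≤ τ) (h1 : τ ≤ 1)
    (S : Finset (Fin n)) : Dᶜ.indicator 1 S ≤ escape D τ S := by
  calc Dᶜ.indicator 1 S = ∑ W, wt τ W * Dᶜ.indicator (1 : Finset (Fin n) → ℝ) S := by
        rw [← sum_mul, sum_wt, one_mul]
    _ ≤ escape D τ S := sum_le_sum fun W _ => mul_le_mul_of_nonneg_left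
        (monotone_compl_indicator hD subset_union_left) (wt_nonneg h0 h1 W)

lemma escape_mono (hD : IsLowerSet D) {a c : ℝ} (h0 : 0 ≤ a) (hac : a ≤ c) (hc : c ≤ 1)
    (S : Finset (Fin n)) : escape D a S ≤ escape D c S := by
  have h := sum_wt_antitone h0 hac hc
    (F := fun W => -Dᶜ.indicator (1 : Finset (Fin n) → ℝ) (S ∪ W)) fun W W' hW =>
      neg_le_neg (monotone_compl_indicator hD (union_subset_union_right hW))
  simp only [mul_neg, sum_neg_distrib, neg_le_neg_iff] at h
  exact h

lemma sum_wt_mul_escape (a b : ℝ) (S : Finset (Fin n)) :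
    ∑ T, wt a T * escape D b (S ∪ T) = escape D (a + b - a * b) S := by
  unfold escape
  rw [← sum_wt_union fun U => Dᶜ.indicator (1 : Finset (Fin n) → ℝ) (S ∪ U)]
  refine sum_congr rfl fun T _ => ?_
  rw [mul_sum]
  exact sum_congr rfl fun W _ => by rw [mul_assoc, union_assoc]

lemma fail_le_fail_sdiff (E O c : Fin k → Finset (Fin n)) (R : Finset (Fin n)) :
    fail D E O R ≤ fail D O (fun j => E j ∪ c j) (R \ univ.biUnion c) := by
  by_cases h : R \ univ.biUnion c ∈ coverable D O fun j => E j ∪ c j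
  · obtain ⟨V, W, hV, hW, hOV, hEW, hcov⟩ := h
    have : R ∈ coverable D E O := by
      refine ⟨W, V, hW, hV, fun j => subset_union_left.trans (hEW j), hOV, fun x hx => ?_⟩
      by_cases hxc : x ∈ univ.biUnion c
      · obtain ⟨j, -, hj⟩ := mem_biUnion.1 hxc
        exact ⟨j, .inl (hEW j (mem_union_right _ hj))⟩
      · obtain ⟨j, hj⟩ := hcov x (mem_sdiff.2 ⟨hx, hxc⟩)
        exact ⟨j, hj.symm⟩
    rw [fail, Set.indicator_of_notMem (by simpa using this)]
    exact fail_nonneg _ _ _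
  · rw [fail, fail, Set.indicator_of_mem (s := (coverable D O _)ᶜ) h]
    exact compl_indicator_le_one _ _

lemma fail_le_sum_indicator (E O : Fin k → Finset (Fin n)) (R : Finset (Fin n)) :
    fail D E O R ≤ (∑ j, Dᶜ.indicator (1 : Finset (Fin n) → ℝ) (E j)) +
      ∑ j, Dᶜ.indicator (1 : Finset (Fin n) → ℝ) (O j) + #R := by
  have hE : ∀ E : Fin k → Finset (Fin n), 0 ≤ ∑ j, Dᶜ.indicator (1 : Finset (Fin n) → ℝ) (E j) :=
    fun E => sum_nonneg fun j _ => compl_indicator_nonneg _ _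
  have hE1 : ∀ E : Fin k → Finset (Fin n), ∀ j, E j ∉ D →
      1 ≤ ∑ j, Dᶜ.indicator (1 : Finset (Fin n) → ℝ) (E j) := fun E j hj =>
    le_trans (le_of_eq (Set.indicator_of_mem (s := Dᶜ) hj 1).symm)
      (single_le_sum (f := fun j => Dᶜ.indicator (1 : Finset (Fin n) → ℝ) (E j))
        (fun j _ => compl_indicator_nonneg _ _) (mem_univ j))
  have h1 := fail_le_one (D := D) E O R
  have hR0 : (0:ℝ) ≤ #R := Nat.cast_nonneg _
  by_cases hEj : ∃ j, E j ∉ D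
  · obtain ⟨j, hj⟩ := hEj
    linarith [hE1 E j hj, hE O]
  by_cases hOj : ∃ j, O j ∉ D
  · obtain ⟨j, hj⟩ := hOj
    linarith [hE1 O j hj, hE E]
  push Not at hEj hOj
  rcases R.eq_empty_or_nonempty with rfl | hR
  · have : ∅ ∈ coverable D E O := ⟨E, O, hEj, hOj, fun _ => Subset.rfl, fun _ => Subset.rfl,
      by simp⟩
    rw [fail, Set.indicator_of_notMem (by simpa using this)]
    linarith [hE E, hE O]
  · have : (1:ℝ) ≤ #R := by exact_mod_cast hR.card_pos
    linarith [hE E, hE O]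

/-- The density `4 exp(-t²/8)`. -/
noncomputable def density (t : ℝ) : ℝ := 4 * Real.exp (-(t ^ 2 / 8))

lemma density_nonneg (t : ℝ) : 0 ≤ density t := by unfold density; positivity

lemma exp_le_quarter {t : ℝ} (ht : 8 ≤ t) : Real.exp (-(t ^ 2 / 8)) ≤ 1 / 4 := by
  have h : Real.log 4 ≤ t ^ 2 / 8 := by
    have := Real.log_le_sub_one_of_pos (show (0:ℝ) < 4 by norm_num)
    nlinarith
  calc Real.exp (-(t ^ 2 / 8)) ≤ Real.exp (-Real.log 4) := Real.exp_le_exp.2 (by linarith)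
    _ = 1 / 4 := by rw [Real.exp_neg, Real.exp_log (by norm_num)]; norm_num

lemma density_le_one {t : ℝ} (ht : 8 ≤ t) : density t ≤ 1 := by
  unfold density; linarith [exp_le_quarter ht]

lemma density_two_mul_le {t : ℝ} (ht : 8 ≤ t) :
    density (2 * t) ≤ Real.exp (-(t ^ 2 / 8)) := by
  have h : density (2 * t) = 4 * (Real.exp (-(t ^ 2 / 8)) * Real.exp (-(3 * t ^ 2 / 8))) := by
    rw [density, ← Real.exp_add]; congr 2; ring
  have h2 : Real.exp (-(3 * t ^ 2 / 8)) ≤ 1 / 4 :=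
    (Real.exp_le_exp.2 (by nlinarith [sq_nonneg t])).trans (exp_le_quarter ht)
  rw [h]
  nlinarith [Real.exp_pos (-(t ^ 2 / 8))]

lemma density_two_mul_le_density {t : ℝ} (ht : 8 ≤ t) : density (2 * t) ≤ density t :=
  (density_two_mul_le ht).trans (by
    unfold density; linarith [Real.exp_pos (-(t ^ 2 / 8))])

lemma tail_add_density_le {t : ℝ} (ht : 8 ≤ t) :
    tail (t / 2) + density (2 * t) ≤ density t := by
  have h1 : tail (t / 2) ≤ Real.exp (-(t ^ 2 / 8)) := by
    refine (tail_le (by linarith)).trans_eq ?_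
    congr 2; ring
  have := density_two_mul_le ht
  unfold density at *
  linarith [Real.exp_pos (-(t ^ 2 / 8))]

variable (D k) in
/-- Covering failures of spread families are controlled, at scale `t`, by escape probabilities. -/
def CoverBound (t : ℝ) : Prop :=
  ∀ (ι : Type) [Fintype ι] (ω : ι → ℝ) (R : ι → Finset (Fin n)) (E : Fin k → Finset (Fin n))
    (O : ι → Fin k → Finset (Fin n)), (∀ i, 0 ≤ ω i) → ∑ i, ω i = 1 →
    (∀ I : Finset (Fin n), ∑ i with I ⊆ R i, ω i ≤ Real.exp (-(20 * t ^ 2)) ^ #I) →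
    ∑ i, ω i * fail D E (O i) (R i) ≤
      ∑ j, escape D (density t) (E j) + ∑ i, ω i * ∑ j, escape D (density t) (O i j) +
        Real.exp (-t ^ 2)

lemma coverBound_of_le (hD : IsLowerSet D) {t : ℝ} (ht : 8 ≤ t)
    (hn : n * Real.exp (-(20 * t ^ 2)) ≤ Real.exp (-t ^ 2)) : CoverBound D k t := by
  intro ι _ ω R E O hω hω1 hsp
  have hcard : ∑ i, ω i * (#(R i) : ℝ) ≤ Real.exp (-t ^ 2) := by
    have h1 : ∀ i, (#(R i) : ℝ) = ∑ x : Fin n, if {x} ⊆ R i then (1:ℝ) else 0 := fun i => by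
      simp
    simp_rw [h1, mul_sum]
    rw [sum_comm]
    refine le_trans ?_ hn
    calc _ ≤ ∑ _x : Fin n, Real.exp (-(20 * t ^ 2)) := by
          refine sum_le_sum fun x _ => ?_
          have := hsp {x}
          rw [card_singleton, pow_one, sum_filter] at this
          refine le_trans (le_of_eq (sum_congr rfl fun i _ => ?_)) this
          rw [mul_ite, mul_one, mul_zero]
      _ = _ := by simp
  have hτ0 := density_nonneg t
  have hτ1 := density_le_one ht
  have hE : ∀ E : Fin k → Finset (Fin n), ∑ j, Dᶜ.indicator (1 : Finset (Fin n) → ℝ) (E j) ≤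
      ∑ j, escape D (density t) (E j) := fun E =>
    sum_le_sum fun j _ => indicator_le_escape hD hτ0 hτ1 _
  calc ∑ i, ω i * fail D E (O i) (R i)
      ≤ ∑ i, ω i * (∑ j, escape D (density t) (E j) + ∑ j, escape D (density t) (O i j)
          + #(R i)) := by
        refine sum_le_sum fun i _ => mul_le_mul_of_nonneg_left ?_ (hω i)
        linarith [fail_le_sum_indicator (D := D) E (O i) (R i), hE E, hE (O i)]
    _ = ∑ j, escape D (density t) (E j) + ∑ i, ω i * ∑ j, escape D (density t) (O i j)
          + ∑ i, ω i * (#(R i) : ℝ) := by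
        simp_rw [mul_add, sum_add_distrib]
        rw [← sum_mul, hω1, one_mul]
    _ ≤ _ := by linarith

lemma IsTransport.spread_sdiff {ι : Type*} [Fintype ι] {R : ι → Finset (Fin n)} {p q : ℝ}
    {s : ι → ℝ} {κ : ι → Finset (Fin n) → ℝ} (h : IsTransport R p q s κ) (hq : 0 ≤ q)
    (i : ι) (I : Finset (Fin n)) :
    ∑ c : Fin k → Finset (Fin n) with I ⊆ R i \ univ.biUnion c, ∏ j, κ i (c j) ≤
      (q ^ k) ^ #I := by
  by_cases hI : I ⊆ R i
  · have hset : (univ.filter fun c : Fin k → Finset (Fin n) => I ⊆ R i \ univ.biUnion c) =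
        Fintype.piFinset fun _ => univ.filter fun W => Disjoint W I := by
      ext c
      simp only [mem_filter, mem_univ, true_and, Fintype.mem_piFinset, subset_sdiff, hI,
        disjoint_biUnion_right, forall_true_left]
      exact forall_congr' fun j => disjoint_comm
    rw [hset, ← prod_univ_sum (fun _ => univ.filter fun W => Disjoint W I) fun _ W => κ i W,
      prod_const, card_univ, Fintype.card_fin, ← pow_mul, mul_comm, pow_mul]
    exact pow_le_pow_left₀ (sum_nonneg fun W _ => h.nonneg i W) (h.miss i I hI) k
  · rw [filter_false_of_mem fun c _ hc => hI (hc.trans sdiff_subset), sum_empty]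
    positivity

lemma IsTransport.sum_mass_mul_fail_le (hD : IsLowerSet D) {ι : Type*} [Fintype ι]
    {R : ι → Finset (Fin n)} {t : ℝ} (ht : 8 ≤ t) {s : ι → ℝ} {κ : ι → Finset (Fin n) → ℝ}
    (h : IsTransport R (tail (t / 2)) (Real.exp (-(t ^ 2 / 8))) s κ)
    (hb : CoverBound D 640 (2 * t)) (E : Fin 640 → Finset (Fin n))
    (O : ι → Fin 640 → Finset (Fin n)) :
    ∑ i, s i * fail D E (O i) (R i) ≤
      ∑ j, escape D (density t) (E j) + ∑ i, s i * ∑ j, escape D (density (2 * t)) (O i j) +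
        (∑ i, s i) * Real.exp (-(4 * t ^ 2)) := by
  classical
  have hτ0 := density_nonneg (2 * t)
  have hτ1 : density (2 * t) ≤ 1 := density_le_one (by linarith)
  have hone : ∀ i, ∑ c : Fin 640 → Finset (Fin n), ∏ j, κ i (c j) = 1 := fun i => by
    have := prod_univ_sum (fun _ : Fin 640 => (univ : Finset (Finset (Fin n))))
      fun _ W => κ i W
    rw [Fintype.piFinset_univ] at this
    rw [← this]
    simp [h.sum_eq_one]
  have hstep : ∀ i, fail D E (O i) (R i) ≤ ∑ j, escape D (density (2 * t)) (O i j) +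
      ∑ W, κ i W * ∑ j, escape D (density (2 * t)) (E j ∪ W) + Real.exp (-(4 * t ^ 2)) := by
    intro i
    have hw0 : ∀ c : Fin 640 → Finset (Fin n), 0 ≤ ∏ j, κ i (c j) := fun c =>
      prod_nonneg fun j _ => h.nonneg i _
    have := hb (Fin 640 → Finset (Fin n)) (fun c => ∏ j, κ i (c j))
      (fun c => R i \ univ.biUnion c) (O i) (fun c j => E j ∪ c j) hw0 (hone i) fun I => by
        refine (h.spread_sdiff (Real.exp_pos _).le i I).trans_eq ?_
        rw [← Real.exp_nat_mul]
        congr 2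
        push_cast; ring
    have hmarg : ∑ c : Fin 640 → Finset (Fin n), (∏ j, κ i (c j)) *
        ∑ j, escape D (density (2 * t)) (E j ∪ c j) =
        ∑ W, κ i W * ∑ j, escape D (density (2 * t)) (E j ∪ W) := by
      simp_rw [mul_sum]
      rw [sum_comm, sum_comm (s := (univ : Finset (Finset (Fin n))))]
      exact sum_congr rfl fun j _ => sum_pi_marginal (h.sum_eq_one i) j
        fun W => escape D (density (2 * t)) (E j ∪ W)
    rw [hmarg, show -(2 * t) ^ 2 = -(4 * t ^ 2) by ring] at this
    refine le_trans ?_ this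
    calc fail D E (O i) (R i)
        = ∑ c : Fin 640 → Finset (Fin n), (∏ j, κ i (c j)) * fail D E (O i) (R i) := by
          rw [← sum_mul, hone, one_mul]
      _ ≤ _ := sum_le_sum fun c _ =>
          mul_le_mul_of_nonneg_left (fail_le_fail_sdiff E (O i) c (R i)) (hw0 c)
  have hE : ∑ i, s i * ∑ W, κ i W * ∑ j, escape D (density (2 * t)) (E j ∪ W) ≤
      ∑ j, escape D (density t) (E j) := by
    calc ∑ i, s i * ∑ W, κ i W * ∑ j, escape D (density (2 * t)) (E j ∪ W)
        = ∑ W, (∑ i, s i * κ i W) * ∑ j, escape D (density (2 * t)) (E j ∪ W) := by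
          simp_rw [mul_sum (s := (univ : Finset (Finset (Fin n)))), sum_mul]
          rw [sum_comm]
          simp_rw [mul_assoc]
      _ ≤ ∑ W, wt (tail (t / 2)) W * ∑ j, escape D (density (2 * t)) (E j ∪ W) :=
          sum_le_sum fun W _ => mul_le_mul_of_nonneg_right (h.sum_le W)
            (sum_nonneg fun j _ => escape_nonneg hτ0 hτ1 _)
      _ = ∑ j, escape D (tail (t / 2) + density (2 * t) - tail (t / 2) * density (2 * t))
            (E j) := by
          simp_rw [mul_sum]
          rw [sum_comm]
          exact sum_congr rfl fun j _ => sum_wt_mul_escape _ _ _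
      _ ≤ ∑ j, escape D (density t) (E j) := by
          have h0 := tail_nonneg (t / 2)
          have h1 := tail_le_one (t / 2)
          refine sum_le_sum fun j _ => escape_mono hD ?_ ?_ (density_le_one ht) _
          · nlinarith
          · nlinarith [tail_add_density_le ht, mul_nonneg h0 hτ0]
  calc ∑ i, s i * fail D E (O i) (R i)
      ≤ ∑ i, s i * (∑ j, escape D (density (2 * t)) (O i j) +
          ∑ W, κ i W * ∑ j, escape D (density (2 * t)) (E j ∪ W) + Real.exp (-(4 * t ^ 2))) :=
        sum_le_sum fun i _ => mul_le_mul_of_nonneg_left (hstep i) (h.mass_nonneg i)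
    _ = ∑ i, s i * ∑ j, escape D (density (2 * t)) (O i j) +
          ∑ i, s i * ∑ W, κ i W * ∑ j, escape D (density (2 * t)) (E j ∪ W) +
          (∑ i, s i) * Real.exp (-(4 * t ^ 2)) := by
        simp_rw [mul_add, sum_add_distrib]
        rw [sum_mul]
    _ ≤ _ := by linarith

lemma coverBound_of_two_mul (hD : IsLowerSet D) {t : ℝ} (ht : 8 ≤ t)
    (hb : CoverBound D 640 (2 * t)) : CoverBound D 640 t := by
  intro ι _ ω R E O hω hω1 hsp
  obtain ⟨s, κ, hT, hle, hloss⟩ := exists_isTransport_of_spread R ht hω hω1 hsp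
  have h1 := hT.sum_mass_mul_fail_le hD ht hb E O
  have hτ0 := density_nonneg (2 * t)
  have hτ1 : density (2 * t) ≤ 1 := density_le_one (by linarith)
  have h2 : ∑ i, s i * ∑ j, escape D (density (2 * t)) (O i j) ≤
      ∑ i, ω i * ∑ j, escape D (density t) (O i j) :=
    sum_le_sum fun i _ => mul_le_mul (hle i)
      (sum_le_sum fun j _ => escape_mono hD hτ0 (density_two_mul_le_density ht)
        (density_le_one ht) _)
      (sum_nonneg fun j _ => escape_nonneg hτ0 hτ1 _) (hω i)
  have h3 : ∑ i, ω i * fail D E (O i) (R i) ≤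
      ∑ i, s i * fail D E (O i) (R i) + ∑ i, (ω i - s i) := by
    rw [← sum_add_distrib]
    refine sum_le_sum fun i _ => ?_
    nlinarith [hle i, fail_le_one (D := D) E (O i) (R i)]
  have h4 : (∑ i, s i) * Real.exp (-(4 * t ^ 2)) ≤ Real.exp (-(4 * t ^ 2)) :=
    mul_le_of_le_one_left (Real.exp_pos _).le hT.sum_mass
  have h5 : Real.exp (-(4 * t ^ 2)) + Real.exp (-(16 * t ^ 2)) ≤ Real.exp (-t ^ 2) := by
    have e1 : Real.exp (-(4 * t ^ 2)) = Real.exp (-t ^ 2) * Real.exp (-(3 * t ^ 2)) := by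
      rw [← Real.exp_add]; congr 1; ring
    have e2 : Real.exp (-(16 * t ^ 2)) ≤ Real.exp (-(4 * t ^ 2)) :=
      Real.exp_le_exp.2 (by nlinarith)
    have e3 : Real.exp (-(3 * t ^ 2)) ≤ 1 / 4 :=
      (Real.exp_le_exp.2 (by nlinarith [sq_nonneg t])).trans (exp_le_quarter ht)
    nlinarith [Real.exp_pos (-t ^ 2)]
  linarith

theorem coverBound (hD : IsLowerSet D) {t : ℝ} (ht : 8 ≤ t) : CoverBound D 640 t := by
  have key : ∀ m : ℕ, ∀ t : ℝ, 8 ≤ t →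
      n * Real.exp (-(20 * (2 ^ m * t) ^ 2)) ≤ Real.exp (-(2 ^ m * t) ^ 2) →
      CoverBound D 640 t := by
    intro m
    induction m with
    | zero => exact fun t ht h => coverBound_of_le hD ht (by simpa using h)
    | succ m ih =>
      intro t ht h
      refine coverBound_of_two_mul hD ht (ih (2 * t) (by linarith) ?_)
      rwa [pow_succ (2 : ℝ) m, mul_assoc ((2 : ℝ) ^ m)] at h
  refine key n t ht ?_
  set u := (2 : ℝ) ^ n * t
  have hnu : (n : ℝ) ≤ u ^ 2 := by
    have h1 : (n : ℝ) ≤ 2 ^ n := by exact_mod_cast Nat.lt_two_pow_self.le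
    have h2 : (1 : ℝ) ≤ 2 ^ n := one_le_pow₀ (by norm_num)
    have h3 : (2 : ℝ) ^ n ≤ u := le_mul_of_one_le_right (by positivity) (by linarith)
    nlinarith
  calc n * Real.exp (-(20 * u ^ 2)) ≤ Real.exp (u ^ 2) * Real.exp (-(20 * u ^ 2)) := by
        refine mul_le_mul_of_nonneg_right ?_ (Real.exp_pos _).le
        linarith [Real.add_one_le_exp (u ^ 2)]
    _ = Real.exp (-(19 * u ^ 2)) := by rw [← Real.exp_add]; congr 1; ring
    _ ≤ Real.exp (-u ^ 2) := Real.exp_le_exp.2 (by nlinarith [sq_nonneg u])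

end Recursion

section Final

variable {n : ℕ}

/-- Sets contained in the support of an element of `A`. -/
def lowerSupports (A : Set (Fin n → Bool)) : Set (Finset (Fin n)) :=
  {S | ∃ a ∈ A, S ⊆ boolEquiv (Fin n) a}

lemma isLowerSet_lowerSupports (A : Set (Fin n → Bool)) : IsLowerSet (lowerSupports A) :=
  fun _ _ hTS ⟨a, ha, hS⟩ => ⟨a, ha, hTS.trans hS⟩

lemma escape_lowerSupports_empty_le {A : Set (Fin n → Bool)} {p : ℝ} (h0 : 0 ≤ p) (h1 : p ≤ 1) :
    escape (lowerSupports A) p ∅ ≤ 1 - mup n p A := by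
  have hw : ∑ f : Fin n → Bool, ∏ x, (if f x then p else 1 - p) = 1 := by
    simpa [sum_wt] using (sum_wt_mul (V := Fin n) p fun _ => 1).symm
  rw [escape, sum_wt_mul, mup]
  refine le_trans ?_ (sub_le_sub_right hw.le _)
  rw [← sum_sub_distrib]
  refine sum_le_sum fun f _ => ?_
  have hp : 0 ≤ ∏ x, (if f x then p else 1 - p) :=
    prod_nonneg fun x _ => by split_ifs <;> linarith
  rw [empty_union]
  by_cases hf : f ∈ A
  · have : boolEquiv (Fin n) f ∈ lowerSupports A := ⟨f, hf, Subset.rfl⟩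
    rw [Set.indicator_of_notMem (by simpa using this), Set.indicator_of_mem hf, mul_zero, sub_self]
  · rw [Set.indicator_of_notMem hf, sub_zero]
    exact mul_le_of_le_one_right hp (compl_indicator_le_one _ _)

lemma notMem_uncoverable {A : Set (Fin n → Bool)} {J : Type*} [Fintype J] [Nonempty J] {q : ℕ}
    (hq : Fintype.card J ≤ q) {x : Fin n → Bool} (V : J → Finset (Fin n))
    (hV : ∀ j, V j ∈ lowerSupports A) (hcov : ∀ i, x i = true → ∃ j, i ∈ V j) :
    x ∉ uncoverable n q A := by
  intro hx
  choose a ha hsub using hV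
  obtain ⟨e⟩ := Function.Embedding.nonempty_of_card_le (β := Fin q) (by simpa using hq)
  obtain ⟨i, hi, hmiss⟩ := hx (fun j => a (Function.invFun e j)) fun j => ha _
  obtain ⟨j, hj⟩ := hcov i hi
  have h1 := (mem_boolEquiv _ _).1 (hsub j hj)
  have h2 := hmiss (e j)
  rw [Function.leftInverse_invFun e.injective j, h1] at h2
  exact absurd h2 (by decide)

/-- A union bound over the classes of a random colouring. -/
lemma uncoverable_eq_empty {A : Set (Fin n → Bool)} {m q : ℕ} (hm : 0 < m) (hq : m ≤ q) {p : ℝ}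
    (hp : 1 / m ≤ p) (hp1 : p ≤ 1) (h : m * escape (lowerSupports A) p ∅ < 1) :
    uncoverable n q A = ∅ := by
  set D := lowerSupports A with hDdef
  have hD : IsLowerSet D := isLowerSet_lowerSupports A
  have : NeZero m := ⟨hm.ne'⟩
  have hex : ∃ c : Fin n → Fin m, ∀ j, (univ.filter fun x => c x = j) ∈ D := by
    by_contra! hcon
    have h1 : ∑ c : Fin n → Fin m, (∏ _x : Fin n, (1 / m : ℝ)) = 1 := by
      simp
    have h2 : ∑ j : Fin m, ∑ c : Fin n → Fin m, (∏ _x : Fin n, (1 / m : ℝ)) *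
        Dᶜ.indicator (1 : Finset (Fin n) → ℝ) (univ.filter fun x => c x = j) ≤
        m * escape D p ∅ := by
      calc _ = ∑ _j : Fin m, escape D (1 / m) ∅ := sum_congr rfl fun j _ => by
            rw [sum_colouring hm j, escape]
            simp_rw [empty_union]
        _ = m * escape D (1 / m) ∅ := by simp
        _ ≤ m * escape D p ∅ :=
            mul_le_mul_of_nonneg_left (escape_mono hD (by positivity) hp hp1 _) (by positivity)
    have h3 : (1 : ℝ) ≤ ∑ j : Fin m, ∑ c : Fin n → Fin m, (∏ _x : Fin n, (1 / m : ℝ)) *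
        Dᶜ.indicator (1 : Finset (Fin n) → ℝ) (univ.filter fun x => c x = j) := by
      rw [sum_comm]
      refine h1.symm.le.trans ?_
      refine sum_le_sum fun c _ => ?_
      rw [← mul_sum]
      refine le_mul_of_one_le_right (by positivity) ?_
      obtain ⟨j, hj⟩ := hcon c
      refine le_trans (le_of_eq (Set.indicator_of_mem (s := Dᶜ) hj 1).symm)
        (single_le_sum (f := fun j => Dᶜ.indicator (1 : Finset (Fin n) → ℝ)
          (univ.filter fun x => c x = j)) (fun j _ => compl_indicator_nonneg _ _) (mem_univ j))
    linarith
  obtain ⟨c, hc⟩ := hex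
  refine Set.eq_empty_of_forall_notMem fun x => ?_
  exact notMem_uncoverable (by simpa using hq) _ hc fun i _ => ⟨c i, by simp⟩

lemma exists_exp_eq_density {p : ℝ} (hp : 0 < p) (hp1 : p < 1 / 1280) :
    ∃ t : ℝ, 8 ≤ t ∧ Real.exp (-(t ^ 2 / 8)) = p / 4 := by
  have hlog : 8 ≤ Real.log (4 / p) := by
    rw [Real.le_log_iff_exp_le (by positivity), le_div_iff₀ hp]
    have h1 : Real.exp 8 ≤ 5120 := by
      rw [show (8 : ℝ) = ((8 : ℕ) : ℝ) * 1 by norm_num, Real.exp_nat_mul]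
      calc Real.exp 1 ^ 8 ≤ 2.8 ^ 8 :=
            pow_le_pow_left₀ (Real.exp_pos _).le (by linarith [Real.exp_one_lt_d9]) 8
        _ ≤ 5120 := by norm_num
    nlinarith
  refine ⟨√(8 * Real.log (4 / p)), Real.le_sqrt_of_sq_le (by linarith), ?_⟩
  rw [Real.sq_sqrt (by linarith), mul_div_cancel_left₀ _ (by norm_num), Real.exp_neg,
    Real.exp_log (by positivity), inv_div]

lemma psmall_uncoverable {A : Set (Fin n → Bool)} {p : ℝ} (hp : 0 < p) (hp1 : p < 1 / 1280)
    (hA : 1 - 1 / 2560 ≤ mup n p A) : PSmall n (p ^ (320 : ℝ)) (uncoverable n 2560 A) := by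
  classical
  by_contra hns
  obtain ⟨t, ht, htp⟩ := exists_exp_eq_density hp hp1
  set D := lowerSupports A
  have hD : IsLowerSet D := isLowerSet_lowerSupports A
  have hdens : density t = p := by rw [density, htp]; ring
  have hpow : p ^ (320 : ℝ) ≤ Real.exp (-(20 * t ^ 2)) := by
    have h1 : Real.exp (-(20 * t ^ 2)) = (p / 4) ^ 160 := by
      rw [← htp, ← Real.exp_nat_mul]
      congr 1; push_cast; ring
    rw [h1, Real.rpow_ofNat, show 320 = 2 * 160 by norm_num, pow_mul]
    exact pow_le_pow_left₀ (by positivity) (by nlinarith) 160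
  obtain ⟨K, hK, hmass⟩ := exists_isHitting_of_not_small
    (fun x : {x // x ∈ uncoverable n 2560 A} => boolEquiv (Fin n) x) ht fun 𝒯 h𝒯 => by
      by_contra! hlt
      refine hns ⟨𝒯, fun x hx => ?_, ?_⟩
      · obtain ⟨T, hT, hsub⟩ := h𝒯 ⟨x, hx⟩
        exact Set.mem_biUnion hT fun i hi => (mem_boolEquiv _ _).1 (hsub hi)
      · refine le_trans (sum_le_sum fun T _ => ?_) hlt.le
        exact pow_le_pow_left₀ (by positivity) hpow _
  have hT := hK.isTransport
  have hs := hT.sum_mass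
  have hfail : ∀ x : {x // x ∈ uncoverable n 2560 A},
      fail D (fun _ : Fin 640 => ∅) (fun _ => ∅) (boolEquiv (Fin n) x) = 1 := by
    intro x
    refine Set.indicator_of_mem (s := (coverable D (fun _ : Fin 640 => ∅) fun _ => ∅)ᶜ) ?_ 1
    rintro ⟨V, W, hV, hW, -, -, hcov⟩
    refine notMem_uncoverable (J := Fin 640 ⊕ Fin 640) (by simp) (Sum.elim V W)
      (by rintro (j | j) <;> simp [hV, hW, D]) (fun i hi => ?_) x.2
    obtain ⟨j, hj | hj⟩ := hcov i ((mem_boolEquiv _ _).2 hi)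
    exacts [⟨.inl j, hj⟩, ⟨.inr j, hj⟩]
  have key := hT.sum_mass_mul_fail_le hD ht (coverBound hD (by linarith)) (fun _ => ∅)
    fun _ _ => ∅
  have hesc : escape D p ∅ ≤ 1 / 2560 :=
    (escape_lowerSupports_empty_le hp.le (by linarith)).trans (by linarith)
  have hesc2 : escape D (density (2 * t)) ∅ ≤ 1 / 2560 := by
    refine le_trans (escape_mono hD (density_nonneg _) ?_ (by linarith) _) hesc
    exact (density_two_mul_le_density ht).trans_eq hdens
  simp only [hfail, mul_one, hdens, sum_const, card_univ, Fintype.card_fin, nsmul_eq_mul,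
    ← sum_mul] at key
  have hexp : Real.exp (-(4 * t ^ 2)) < 1 / 5 := by
    refine (Real.exp_le_exp.2 (?_ : -(4 * t ^ 2) ≤ -(t ^ 2 / 8))).trans_lt ?_
    · nlinarith [sq_nonneg t]
    · rw [htp]; linarith
  have hexp16 : Real.exp (-(16 * t ^ 2)) ≤ Real.exp (-(4 * t ^ 2)) :=
    Real.exp_le_exp.2 (by nlinarith [sq_nonneg t])
  set σ := ∑ i : {x // x ∈ uncoverable n 2560 A}, ∑ W, K i W
  have hσ0 : 0 ≤ σ := sum_nonneg fun i _ => hT.mass_nonneg i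
  have h1 : σ * Real.exp (-(4 * t ^ 2)) ≤ 1 / 5 := by
    nlinarith [Real.exp_pos (-(4 * t ^ 2))]
  have h2 : σ * (((640 : ℕ) : ℝ) * escape D (density (2 * t)) ∅) ≤ 1 / 4 := by
    push_cast
    calc σ * (640 * escape D (density (2 * t)) ∅) ≤ σ * (640 * (1 / 2560)) := by gcongr
      _ ≤ 1 / 4 := by linarith
  push_cast at key h2
  linarith

end Final

end SmallSets

/-- There exist an integer `q > 0` and `L ≥ 1` such that for every `N ≥ 1`, every
`0 < p < 1` and every `A ⊆ {0,1}^N` with `μ_p(A) ≥ 1 - 1/q`, the set `A^(q)` is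
`p^L`-small. -/
theorem statement_3 :
    ∃ q : ℕ, 0 < q ∧ ∃ L : ℝ, 1 ≤ L ∧
      ∀ N : ℕ, 1 ≤ N →
        ∀ p : ℝ, 0 < p → p < 1 →
          ∀ A : Set (Fin N → Bool),
            1 - 1 / (q : ℝ) ≤ mup N p A →
            PSmall N (p ^ L) (uncoverable N q A) := by
  refine ⟨2560, by norm_num, 320, by norm_num, fun N _ p hp hp1 A hA => ?_⟩
  rw [Nat.cast_ofNat] at hA
  rcases lt_or_ge p (1 / 1280) with h | h
  · exact SmallSets.psmall_uncoverable hp h hA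
  · have hesc := SmallSets.escape_lowerSupports_empty_le (A := A) hp.le hp1.le
    rw [SmallSets.uncoverable_eq_empty (m := 1280) (p := p) (by norm_num) (by norm_num)
      (by simpa using h) hp1.le (by push_cast; linarith)]
    exact ⟨∅, by simp, by simp⟩
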